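/- arXiv:2302.11051 — 7 statements merged into one kernel-verified Lean document; each statement's English description precedes it below -/
import Mathlib

section
/- Subsequence convergence of FedSLR (Theorem 1, part i). Assume 0 < η_g < 1/(2L), that the gradients are uniformly bounded (there is B > 0 with ‖∇f_i(w)‖ ≤ B for all i and all w ∈ ℝ^d), that the losses are uniformly bounded below (there is f_low ∈ ℝ with f_i(w) ≥ f_low for all i, w), and that a cluster point exists along the subsequence (t^j). Then for every i ∈ {1,…,M}: ‖w_{i,t+1} − w_{i,t}‖ → 0, ‖w_{t+1} − w_t‖ → 0 and ‖γ_{i,t+1} − γ_{i,t}‖ → 0 as t → ∞; consequently the shifted subsequences converge to the same cluster point: w_{t^j+1} → w*, w_{i,t^j+1} → w_i*, and γ_{i,t^j+1} → γ_i* as j → ∞. -/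
open Filter Topology Finset MeasureTheory RealInnerProductSpace

noncomputable section

abbrev Vec (d : ℕ) := EuclideanSpace ℝ (Fin d)

def subgrad {d : ℕ} (R : Vec d → ℝ) (x : Vec d) : Set (Vec d) :=
  {g | ∀ y, R x + ⟪g, y - x⟫ ≤ R y}

section Smooth

variable {E : Type*} [NormedAddCommGroup E] [InnerProductSpace ℝ E] [CompleteSpace E]

theorem le_add_inner_add_sq_of_lipschitz_gradient {f : E → ℝ} {f' : E → E} {L : ℝ}
    (hgrad : ∀ x, HasGradientAt f (f' x) x)
    (hlip : ∀ x y, ‖f' x - f' y‖ ≤ L * ‖x - y‖) (x y : E) :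
    f y ≤ f x + ⟪f' x, y - x⟫ + L / 2 * ‖y - x‖ ^ 2 := by
  set v := y - x with hv
  have hderiv : ∀ s : ℝ, HasDerivAt
      (fun s : ℝ => f (x + s • v) - s * ⟪f' x, v⟫ - L / 2 * ‖v‖ ^ 2 * s ^ 2)
      (⟪f' (x + s • v), v⟫ - ⟪f' x, v⟫ - L / 2 * ‖v‖ ^ 2 * (2 * s)) s := by
    intro s
    have h1 : HasDerivAt (fun s : ℝ => x + s • v) v s := by
      simpa using ((hasDerivAt_id s).smul_const v).const_add x
    have h2 : HasDerivAt (fun s : ℝ => f (x + s • v)) ⟪f' (x + s • v), v⟫ s := by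
      simpa [Function.comp_def] using (hgrad (x + s • v)).hasFDerivAt.comp_hasDerivAt s h1
    have h3 : HasDerivAt (fun s : ℝ => s * ⟪f' x, v⟫) ⟪f' x, v⟫ s := by
      simpa using (hasDerivAt_id s).mul_const ⟪f' x, v⟫
    have h4 : HasDerivAt (fun s : ℝ => L / 2 * ‖v‖ ^ 2 * s ^ 2)
        (L / 2 * ‖v‖ ^ 2 * (2 * s)) s := by
      simpa using (hasDerivAt_pow 2 s).const_mul (L / 2 * ‖v‖ ^ 2)
    exact (h2.sub h3).sub h4
  have hanti := antitoneOn_of_deriv_nonpos (convex_Icc (0 : ℝ) 1)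
    (fun s _ => (hderiv s).continuousAt.continuousWithinAt)
    (fun s _ => (hderiv s).differentiableAt.differentiableWithinAt)
    (fun s hs => by
      rw [interior_Icc] at hs
      rw [(hderiv s).deriv, ← inner_sub_left]
      have h1 := real_inner_le_norm (f' (x + s • v) - f' x) v
      have h2 := hlip (x + s • v) x
      rw [add_sub_cancel_left, norm_smul, Real.norm_of_nonneg hs.1.le] at h2
      nlinarith [mul_le_mul_of_nonneg_right h2 (norm_nonneg v)])
  have h := hanti (Set.left_mem_Icc.2 zero_le_one) (Set.right_mem_Icc.2 zero_le_one) zero_le_one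
  have hxy : x + v = y := by simp [hv]
  simp only [one_smul, zero_smul, add_zero, hxy] at h
  linarith

theorem sub_sq_le_of_lipschitz_gradient {f : E → ℝ} {f' : E → E} {L : ℝ}
    (hgrad : ∀ x, HasGradientAt f (f' x) x)
    (hlip : ∀ x y, ‖f' x - f' y‖ ≤ L * ‖x - y‖) (x y : E) :
    f x + ⟪f' x, y - x⟫ - L / 2 * ‖y - x‖ ^ 2 ≤ f y := by
  have h := le_add_inner_add_sq_of_lipschitz_gradient (f := fun z => -f z)
    (f' := fun z => -f' z) (L := L)
    (fun z => by
      have := (hgrad z).hasFDerivAt.neg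
      rw [hasGradientAt_iff_hasFDerivAt, map_neg]
      exact this)
    (fun a b => by
      rw [← neg_sub', norm_neg]
      exact hlip a b) x y
  simp only [inner_neg_left] at h
  linarith

/-- First-order optimality for a linearly tilted proximal step. -/
theorem gradient_eq_of_prox_minimizer {f : E → ℝ} {g p γ u : E} {η : ℝ}
    (hgrad : HasGradientAt f g p)
    (hmin : ∀ v, f p - ⟪γ, p⟫ + (2 * η)⁻¹ * ‖u - p‖ ^ 2
      ≤ f v - ⟪γ, v⟫ + (2 * η)⁻¹ * ‖u - v‖ ^ 2) :
    g = γ + η⁻¹ • (u - p) := by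
  have h1 := (((hasFDerivAt_id (𝕜 := ℝ) p).const_sub u).norm_sq).const_mul (2 * η)⁻¹
  have h2 := (hgrad.hasFDerivAt.sub (innerSL ℝ γ).hasFDerivAt).add h1
  have hloc : IsLocalMin (fun v => f v - ⟪γ, v⟫ + (2 * η)⁻¹ * ‖u - v‖ ^ 2) p :=
    Filter.Eventually.of_forall hmin
  have h3 := hloc.hasFDerivAt_eq_zero h2
  refine ext_inner_right ℝ fun v => ?_
  have h4 := congrArg (fun l : E →L[ℝ] ℝ => l v) h3
  simp only [add_apply, sub_apply,
    smul_apply, ContinuousLinearMap.comp_apply, neg_apply,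
    zero_apply, InnerProductSpace.toDual_apply_apply, innerSL_apply_apply,
    ContinuousLinearMap.id_apply, inner_neg_right, smul_eq_mul, nsmul_eq_mul, id] at h4
  rw [inner_add_left, real_inner_smul_left]
  rw [mul_inv] at h4
  norm_num at h4
  linarith

/-- Per-client decrease of the augmented Lagrangian under the primal and dual updates. -/
theorem augmented_lagrangian_descent {f : E → ℝ} {f' : E → E} {L η : ℝ} (hη : 0 < η)
    (hgrad : ∀ x, HasGradientAt f (f' x) x)
    (hlip : ∀ x y, ‖f' x - f' y‖ ≤ L * ‖x - y‖) {u p q : E}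
    (hp : f' p = f' q + η⁻¹ • (u - p)) :
    f p + ⟪f' p, u - p⟫ + (2 * η)⁻¹ * ‖u - p‖ ^ 2
        + ((2 * η)⁻¹ - L / 2 - η * L ^ 2) * ‖p - q‖ ^ 2
      ≤ f q + ⟪f' q, u - q⟫ + (2 * η)⁻¹ * ‖u - q‖ ^ 2 := by
  have h1 := sub_sq_le_of_lipschitz_gradient hgrad hlip p q
  have h2 : u - p = η • (f' p - f' q) := by
    rw [hp, add_sub_cancel_left, smul_inv_smul₀ hη.ne']
  have h3 : ‖f' p - f' q‖ ^ 2 ≤ L ^ 2 * ‖p - q‖ ^ 2 := by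
    rw [← mul_pow]
    exact pow_le_pow_left₀ (norm_nonneg _) (hlip p q) 2
  have h4 : ⟪f' p, u - p⟫ = ⟪f' q, u - p⟫ + η * ‖f' p - f' q‖ ^ 2 := by
    rw [← real_inner_self_eq_norm_sq, ← real_inner_smul_right, ← h2, inner_sub_left]
    ring
  have h5 : u - q = (u - p) + (p - q) := by abel
  have h6 : q - p = -(p - q) := by abel
  have h7 : ⟪f' p, p - q⟫ = ⟪f' q, p - q⟫ + η⁻¹ * ⟪u - p, p - q⟫ := by
    rw [hp, inner_add_left, real_inner_smul_left]
  rw [h6, inner_neg_right, norm_neg] at h1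
  rw [h5, inner_add_right, norm_add_sq_real, h4]
  have h8 : (2 * η)⁻¹ = η⁻¹ / 2 := by rw [mul_inv]; ring
  rw [h8]
  nlinarith [mul_le_mul_of_nonneg_left h3 hη.le]

theorem le_augmented_lagrangian {f : E → ℝ} {f' : E → E} {L η : ℝ}
    (hη : L / 2 ≤ (2 * η)⁻¹) (hgrad : ∀ x, HasGradientAt f (f' x) x)
    (hlip : ∀ x y, ‖f' x - f' y‖ ≤ L * ‖x - y‖) (x y : E) :
    f x ≤ f y + ⟪f' y, x - y⟫ + (2 * η)⁻¹ * ‖x - y‖ ^ 2 := by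
  have h := le_add_inner_add_sq_of_lipschitz_gradient hgrad hlip y x
  nlinarith [mul_le_mul_of_nonneg_right hη (sq_nonneg ‖x - y‖)]

end Smooth

section Prox

variable {E : Type*} [NormedAddCommGroup E] [InnerProductSpace ℝ E]

theorem ConvexOn.prox_minimizer_add_sq_le {R : E → ℝ} (hR : ConvexOn ℝ Set.univ R)
    {ι : Type*} [Fintype ι] {γ : ι → E} {m c : ℝ} {a p : E}
    (hmin : ∀ v, R p + m * ∑ i, ⟪γ i, p⟫ + c * ‖p - a‖ ^ 2
      ≤ R v + m * ∑ i, ⟪γ i, v⟫ + c * ‖v - a‖ ^ 2) (v : E) :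
    R p + m * ∑ i, ⟪γ i, p⟫ + c * ‖p - a‖ ^ 2 + c / 2 * ‖p - v‖ ^ 2
      ≤ R v + m * ∑ i, ⟪γ i, v⟫ + c * ‖v - a‖ ^ 2 := by
  have h1 := hmin ((1 / 2 : ℝ) • p + (1 / 2 : ℝ) • v)
  have h2 := hR.2 (Set.mem_univ p) (Set.mem_univ v) (by norm_num : (0 : ℝ) ≤ 1 / 2)
    (by norm_num : (0 : ℝ) ≤ 1 / 2) (by norm_num)
  have h3 : (1 / 2 : ℝ) • p + (1 / 2 : ℝ) • v - a
      = (1 / 2 : ℝ) • ((p - a) + (v - a)) := by module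
  have h4 : p - v = (p - a) - (v - a) := by abel
  simp only [← sum_inner] at h1 ⊢
  rw [h3, norm_smul, mul_pow, norm_add_sq_real, inner_add_right, real_inner_smul_right,
    real_inner_smul_right] at h1
  rw [h4, norm_sub_sq_real (p - a)]
  simp only [smul_eq_mul] at h2
  norm_num at h1 h2
  linarith

theorem mean_norm_sub_sq_sub {M : ℕ} (hM : 1 ≤ M) (y : Fin M → E) (x z : E) :
    (M : ℝ)⁻¹ * ∑ i, ‖x - y i‖ ^ 2 - (M : ℝ)⁻¹ * ∑ i, ‖z - y i‖ ^ 2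
      = ‖x - (M : ℝ)⁻¹ • ∑ i, y i‖ ^ 2 - ‖z - (M : ℝ)⁻¹ • ∑ i, y i‖ ^ 2 := by
  have hM0 : (M : ℝ) ≠ 0 := by positivity
  simp only [norm_sub_sq_real, Finset.sum_add_distrib, Finset.sum_sub_distrib,
    ← Finset.mul_sum, ← inner_sum, Finset.sum_const, Finset.card_univ, Fintype.card_fin,
    nsmul_eq_mul, real_inner_smul_right]
  field_simp
  ring

end Prox

theorem tendsto_zero_of_add_le {a b : ℕ → ℝ} {l : ℝ} (hl : ∀ n, l ≤ a n)
    (hb : ∀ n, 0 ≤ b n) (hab : ∀ n, a (n + 1) + b n ≤ a n) : Tendsto b atTop (𝓝 0) := by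
  have hanti : Antitone a := antitone_nat_of_succ_le fun n => by linarith [hab n, hb n]
  have ha := tendsto_atTop_ciInf hanti ⟨l, by rintro _ ⟨n, rfl⟩; exact hl n⟩
  have hdiff : Tendsto (fun n => a n - a (n + 1)) atTop (𝓝 0) := by
    simpa using ha.sub (ha.comp (tendsto_add_atTop_nat 1))
  exact squeeze_zero hb (fun n => by linarith [hab n]) hdiff

theorem tendsto_norm_zero_of_mul_sq_le {E : Type*} [SeminormedAddCommGroup E] {x : ℕ → E}
    {b : ℕ → ℝ} {c : ℝ} (hc : 0 < c) (hxb : ∀ n, c * ‖x n‖ ^ 2 ≤ b n)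
    (hb : Tendsto b atTop (𝓝 0)) : Tendsto (fun n => ‖x n‖) atTop (𝓝 0) := by
  have h : Tendsto (fun n => ‖x n‖ ^ 2) atTop (𝓝 0) :=
    squeeze_zero (fun n => by positivity)
      (fun n => (le_div_iff₀' hc).2 (hxb n)) (by simpa using hb.div_const c)
  simpa [Real.sqrt_sq] using h.sqrt

theorem tendsto_comp_add_one_of_norm_sub {E : Type*} [SeminormedAddCommGroup E] {x : ℕ → E}
    {a : E} {ts : ℕ → ℕ} (hts : Tendsto ts atTop atTop)
    (hx : Tendsto (fun t => ‖x (t + 1) - x t‖) atTop (𝓝 0))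
    (hcl : Tendsto (fun j => x (ts j)) atTop (𝓝 a)) :
    Tendsto (fun j => x (ts j + 1)) atTop (𝓝 a) := by
  simpa using ((tendsto_zero_iff_norm_tendsto_zero.2 hx).comp hts).add hcl

theorem fedslr_subsequence_convergence
    (d M : ℕ) (hd : 1 ≤ d) (hM : 1 ≤ M)
    (L ηg : ℝ) (hL : 0 < L) (hηg : 0 < ηg)
    (f : Fin M → Vec d → ℝ) (f' : Fin M → Vec d → Vec d)
    (hgrad : ∀ i x, HasGradientAt (f i) (f' i x) x)
    (hlip : ∀ i (x y : Vec d), ‖f' i x - f' i y‖ ≤ L * ‖x - y‖)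
    (R : Vec d → ℝ) (hRconv : ConvexOn ℝ Set.univ R) (hRnn : ∀ x, 0 ≤ R x)
    (w : ℕ → Vec d) (wi γi : Fin M → ℕ → Vec d)
    (hloc : ∀ i t (v : Vec d),
      f i (wi i (t+1)) - ⟪γi i t, wi i (t+1)⟫ + (2*ηg)⁻¹ * ‖w t - wi i (t+1)‖^2
        ≤ f i v - ⟪γi i t, v⟫ + (2*ηg)⁻¹ * ‖w t - v‖^2)
    (hdual : ∀ i t, γi i (t+1) = γi i t + ηg⁻¹ • (w t - wi i (t+1)))
    (hagg : ∀ t (v : Vec d), v ≠ w (t+1) →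
      R (w (t+1)) + (M:ℝ)⁻¹ * ∑ i, ⟪γi i (t+1), w (t+1)⟫
          + (2*ηg)⁻¹ * ‖w (t+1) - (M:ℝ)⁻¹ • ∑ i, wi i (t+1)‖^2
        < R v + (M:ℝ)⁻¹ * ∑ i, ⟪γi i (t+1), v⟫
          + (2*ηg)⁻¹ * ‖v - (M:ℝ)⁻¹ • ∑ i, wi i (t+1)‖^2)
    (hηg' : ηg < 1 / (2 * L))
    (B : ℝ) (hB : 0 < B) (hBgrad : ∀ i x, ‖f' i x‖ ≤ B)
    (flow : ℝ) (hflow : ∀ i x, flow ≤ f i x)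
    (ts : ℕ → ℕ) (hts : StrictMono ts) (hts1 : 1 ≤ ts 0)
    (wst : Vec d) (wist γist : Fin M → Vec d)
    (hclw : Tendsto (fun j => w (ts j)) atTop (𝓝 wst))
    (hclwi : ∀ i, Tendsto (fun j => wi i (ts j)) atTop (𝓝 (wist i)))
    (hclγ : ∀ i, Tendsto (fun j => γi i (ts j)) atTop (𝓝 (γist i)))
 :
    (∀ i, Tendsto (fun t => ‖wi i (t+1) - wi i t‖) atTop (𝓝 0)) ∧
    Tendsto (fun t => ‖w (t+1) - w t‖) atTop (𝓝 0) ∧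
    (∀ i, Tendsto (fun t => ‖γi i (t+1) - γi i t‖) atTop (𝓝 0)) ∧
    Tendsto (fun j => w (ts j + 1)) atTop (𝓝 wst) ∧
    (∀ i, Tendsto (fun j => wi i (ts j + 1)) atTop (𝓝 (wist i))) ∧
    (∀ i, Tendsto (fun j => γi i (ts j + 1)) atTop (𝓝 (γist i))) := by
  have hγ : ∀ i t, γi i (t + 1) = f' i (wi i (t + 1)) := fun i t => by
    rw [hdual, gradient_eq_of_prox_minimizer (hgrad i _) (hloc i t)]
  have hM0 : (0 : ℝ) < (M : ℝ)⁻¹ := by positivity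
  have hηL : ηg * L < 1 / 2 := by
    rw [lt_div_iff₀ (by positivity)] at hηg'
    linarith
  have hc : (0 : ℝ) < (2 * ηg)⁻¹ := by positivity
  have hcη : (2 * ηg)⁻¹ * ηg = 1 / 2 := by field_simp
  have hLc : L / 2 ≤ (2 * ηg)⁻¹ := by
    have : L / 2 * ηg ≤ (2 * ηg)⁻¹ * ηg := by rw [hcη]; linarith
    exact le_of_mul_le_mul_right this hηg
  set κ : ℝ := (2 * ηg)⁻¹ - L / 2 - ηg * L ^ 2 with hκ_def
  have hκ : 0 < κ := by
    have h : 0 < κ * ηg := by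
      have : κ * ηg = (1 / 2 - ηg * L) * (1 + ηg * L) := by
        rw [hκ_def, sub_mul, sub_mul, hcη]; ring
      rw [this]
      exact mul_pos (by linarith) (by positivity)
    exact pos_of_mul_pos_left h hηg.le
  let h (i : Fin M) (x y : Vec d) : ℝ :=
    f i y + ⟪f' i y, x - y⟫ + (2 * ηg)⁻¹ * ‖x - y‖ ^ 2
  let D (t : ℕ) : ℝ := R (w (t + 1)) + (M : ℝ)⁻¹ * ∑ i, h i (w (t + 1)) (wi i (t + 1))
  let b (t : ℕ) : ℝ := (2 * ηg)⁻¹ / 2 * ‖w (t + 2) - w (t + 1)‖ ^ 2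
    + (M : ℝ)⁻¹ * ∑ i, κ * ‖wi i (t + 2) - wi i (t + 1)‖ ^ 2
  have hDlow : ∀ t, flow ≤ D t := fun t => by
    have h1 : ∑ _i : Fin M, flow ≤ ∑ i, h i (w (t + 1)) (wi i (t + 1)) :=
      Finset.sum_le_sum fun i _ => (hflow i (w (t + 1))).trans
        (le_augmented_lagrangian hLc (hgrad i) (hlip i) _ _)
    have h2 : (M : ℝ)⁻¹ * ∑ _i : Fin M, flow = flow := by
      simp only [Finset.sum_const, Finset.card_univ, Fintype.card_fin, nsmul_eq_mul]
      exact inv_mul_cancel_left₀ (inv_pos.1 hM0).ne' _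
    have h3 := mul_le_mul_of_nonneg_left h1 hM0.le
    linarith [hRnn (w (t + 1))]
  have hb : ∀ t, 0 ≤ b t := fun t => by positivity
  have hserver : ∀ t, R (w (t + 2)) + (M : ℝ)⁻¹ * ∑ i, h i (w (t + 2)) (wi i (t + 2))
      + (2 * ηg)⁻¹ / 2 * ‖w (t + 2) - w (t + 1)‖ ^ 2
      ≤ R (w (t + 1)) + (M : ℝ)⁻¹ * ∑ i, h i (w (t + 1)) (wi i (t + 2)) := fun t => by
    have h1 := hRconv.prox_minimizer_add_sq_le (γ := fun i => γi i (t + 2)) (fun v => by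
      rcases eq_or_ne v (w (t + 2)) with rfl | hv
      · exact le_rfl
      · exact (hagg (t + 1) v hv).le) (w (t + 1))
    have h2 := congrArg (fun r => (2 * ηg)⁻¹ * r)
      (mean_norm_sub_sq_sub hM (fun i => wi i (t + 2)) (w (t + 2)) (w (t + 1)))
    have h3 : ∀ i, γi i (t + 2) = f' i (wi i (t + 2)) := fun i => hγ i (t + 1)
    simp only [h3] at h1
    simp only [h, inner_sub_right, Finset.sum_add_distrib, Finset.sum_sub_distrib,
      ← Finset.mul_sum]
    linarith
  have hclient : ∀ t, (M : ℝ)⁻¹ * ∑ i, h i (w (t + 1)) (wi i (t + 2))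
      + (M : ℝ)⁻¹ * ∑ i, κ * ‖wi i (t + 2) - wi i (t + 1)‖ ^ 2
      ≤ (M : ℝ)⁻¹ * ∑ i, h i (w (t + 1)) (wi i (t + 1)) := fun t => by
    rw [← mul_add, ← Finset.sum_add_distrib]
    refine mul_le_mul_of_nonneg_left (Finset.sum_le_sum fun i _ => ?_) hM0.le
    refine augmented_lagrangian_descent hηg (hgrad i) (hlip i) ?_
    rw [← hγ i (t + 1), ← hγ i t, hdual i (t + 1)]
  have hb0 : Tendsto b atTop (𝓝 0) :=
    tendsto_zero_of_add_le hDlow hb fun t => by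
      dsimp only [D, b]
      linarith [hserver t, hclient t]
  have hwi : ∀ i, Tendsto (fun t => ‖wi i (t + 1) - wi i t‖) atTop (𝓝 0) := fun i => by
    refine (tendsto_add_atTop_iff_nat 1).1
      (tendsto_norm_zero_of_mul_sq_le (mul_pos hM0 hκ) (fun t => ?_) hb0)
    have h1 := Finset.single_le_sum
      (f := fun k => κ * ‖wi k (t + 2) - wi k (t + 1)‖ ^ 2)
      (fun k _ => by positivity) (Finset.mem_univ i)
    have h2 := mul_le_mul_of_nonneg_left h1 hM0.le
    have h3 : 0 ≤ (2 * ηg)⁻¹ / 2 * ‖w (t + 2) - w (t + 1)‖ ^ 2 := by positivity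
    rw [mul_assoc]
    exact h2.trans (le_add_of_nonneg_left h3)
  have hw : Tendsto (fun t => ‖w (t + 1) - w t‖) atTop (𝓝 0) := by
    refine (tendsto_add_atTop_iff_nat 1).1
      (tendsto_norm_zero_of_mul_sq_le (half_pos hc) (fun t => ?_) hb0)
    exact le_add_of_nonneg_right (by positivity)
  have hγi : ∀ i, Tendsto (fun t => ‖γi i (t + 1) - γi i t‖) atTop (𝓝 0) := fun i => by
    refine (tendsto_add_atTop_iff_nat 1).1 (squeeze_zero (fun t => norm_nonneg _) (fun t => ?_)
      (by simpa using ((tendsto_add_atTop_iff_nat 1).2 (hwi i)).const_mul L))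
    rw [hγ i (t + 1), hγ i t]
    exact hlip i _ _
  have hts' := hts.tendsto_atTop
  exact ⟨hwi, hw, hγi, tendsto_comp_add_one_of_norm_sub hts' hw hclw,
    fun i => tendsto_comp_add_one_of_norm_sub hts' (hwi i) (hclwi i),
    fun i => tendsto_comp_add_one_of_norm_sub hts' (hγi i) (hclγ i)⟩
end
end

section
/- Finite-iteration stationarity under KL with θ = 0 (Theorem 2, case θ = 0). Assume 0 < η_g < 1/(2L), uniformly bounded gradients (‖∇f_i(w)‖ ≤ B for all i, w), uniformly lower-bounded losses (f_i(w) ≥ f_low for all i, w), existence of a cluster point along a subsequence (t^j), and the KL hypothesis with exponent θ = 0 and constant c > 0 (i.e., for every t ≥ 1 with r_t > 0, 1 ≤ c·dist(0, ∂D(w_t, (w_{i,t}), (γ_{i,t})))). Then there exists t₀ ∈ ℕ such that for every T ≥ t₀, dist(0, {(1/M)Σ_{i=1}^M ∇f_i(w_T) + s : s ∈ ∂R(w_T)}) = 0; equivalently, −(1/M)Σ_{i=1}^M ∇f_i(w_T) ∈ ∂R(w_T) for all T ≥ t₀. -/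
open Filter Topology Finset MeasureTheory RealInnerProductSpace

noncomputable section

def potD {d M : ℕ} (ηg : ℝ) (f : Fin M → Vec d → ℝ) (R : Vec d → ℝ)
    (x : Vec d) (y γv : Fin M → Vec d) : ℝ :=
  (M : ℝ)⁻¹ * ∑ i, f i (y i) + R x + (M : ℝ)⁻¹ * ∑ i, ⟪γv i, x - y i⟫
    + (M : ℝ)⁻¹ * ∑ i, (2 * ηg)⁻¹ * ‖x - y i‖ ^ 2

abbrev Tup (d M : ℕ) := PiLp 2 (fun _ : Unit ⊕ Fin M ⊕ Fin M => Vec d)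

def subdiffD {d M : ℕ} (ηg : ℝ) (f' : Fin M → Vec d → Vec d) (R : Vec d → ℝ)
    (x : Vec d) (y γv : Fin M → Vec d) : Set (Tup d M) :=
  {Tp | ∃ s ∈ subgrad R x,
    Tp (Sum.inl ()) = s + (M : ℝ)⁻¹ • ∑ i, γv i + (ηg * M)⁻¹ • ∑ i, (x - y i) ∧
    (∀ i, Tp (Sum.inr (Sum.inl i)) = (M : ℝ)⁻¹ • (f' i (y i) - γv i - ηg⁻¹ • (x - y i))) ∧
    (∀ i, Tp (Sum.inr (Sum.inr i)) = (M : ℝ)⁻¹ • (x - y i))}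

section InnerProduct

variable {E : Type*} [NormedAddCommGroup E] [InnerProductSpace ℝ E]

lemma nonneg_of_forall_add_mul_nonneg {a b : ℝ}
    (h : ∀ t : ℝ, 0 < t → t ≤ 1 → 0 ≤ a + t * b) : 0 ≤ a := by
  have hlim : Tendsto (fun t : ℝ => a + t * b) (𝓝[>] 0) (𝓝 a) := by
    have : Tendsto (fun t : ℝ => a + t * b) (𝓝 0) (𝓝 (a + 0 * b)) := by
      apply Continuous.tendsto
      fun_prop
    simpa using this.mono_left nhdsWithin_le_nhds
  refine ge_of_tendsto hlim ?_
  filter_upwards [Ioc_mem_nhdsGT (zero_lt_one (α := ℝ))] with t ht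
  exact h t ht.1 ht.2

/-- Quadratic lower bound for functions with Lipschitz gradient. -/
lemma quadratic_lower_bound [CompleteSpace E] {f : E → ℝ} {f' : E → E} {L : ℝ}
    (hgrad : ∀ x, HasGradientAt f (f' x) x)
    (hlip : ∀ x y, ‖f' x - f' y‖ ≤ L * ‖x - y‖) (x v : E) :
    f x + ⟪f' x, v⟫ - L / 2 * ‖v‖ ^ 2 ≤ f (x + v) := by
  let g : ℝ → ℝ := fun t => f (x + t • v) - t * ⟪f' x, v⟫ + L / 2 * ‖v‖ ^ 2 * t ^ 2
  have hg : ∀ t : ℝ, HasDerivAt g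
      (⟪f' (x + t • v), v⟫ - ⟪f' x, v⟫ + L * ‖v‖ ^ 2 * t) t := by
    intro t
    have h1 : HasDerivAt (fun t : ℝ => x + t • v) v t := by
      simpa using ((hasDerivAt_id t).smul_const v).const_add x
    have h2 : HasDerivAt (fun t : ℝ => f (x + t • v)) ⟪f' (x + t • v), v⟫ t := by
      have := (hgrad (x + t • v)).hasFDerivAt.comp_hasDerivAt t h1
      rwa [InnerProductSpace.toDual_apply_apply] at this
    have h3 := (h2.sub ((hasDerivAt_id t).mul_const ⟪f' x, v⟫)).add
      ((hasDerivAt_pow 2 t).const_mul (L / 2 * ‖v‖ ^ 2))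
    refine h3.congr_deriv ?_
    simp only [Nat.cast_ofNat, Nat.add_one_sub_one, pow_one]
    ring
  have hmono : MonotoneOn g (Set.Ici 0) := by
    refine monotoneOn_of_deriv_nonneg (convex_Ici 0)
      (fun t _ => (hg t).continuousAt.continuousWithinAt)
      (fun t _ => (hg t).differentiableAt.differentiableWithinAt) fun t ht => ?_
    rw [interior_Ici, Set.mem_Ioi] at ht
    rw [(hg t).deriv, ← inner_sub_left]
    have h1 := abs_real_inner_le_norm (f' (x + t • v) - f' x) v
    have h2 := hlip (x + t • v) x
    rw [add_sub_cancel_left, norm_smul, Real.norm_of_nonneg ht.le] at h2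
    have h3 := mul_le_mul_of_nonneg_right h2 (norm_nonneg v)
    have h4 := (abs_le.1 h1).1
    linarith
  have h := hmono Set.self_mem_Ici (Set.mem_Ici.2 zero_le_one) zero_le_one
  simp only [g, zero_smul, one_smul, add_zero] at h
  linarith

lemma quadratic_upper_bound [CompleteSpace E] {f : E → ℝ} {f' : E → E} {L : ℝ}
    (hgrad : ∀ x, HasGradientAt f (f' x) x)
    (hlip : ∀ x y, ‖f' x - f' y‖ ≤ L * ‖x - y‖) (x v : E) :
    f (x + v) ≤ f x + ⟪f' x, v⟫ + L / 2 * ‖v‖ ^ 2 := by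
  have h := quadratic_lower_bound (f := fun x => -f x) (f' := fun x => -f' x) (L := L)
    (fun x => by
      rw [hasGradientAt_iff_hasFDerivAt, map_neg]
      exact (hgrad x).hasFDerivAt.neg)
    (fun x y => by
      rw [neg_sub_neg, norm_sub_rev]
      exact hlip x y) x v
  rw [inner_neg_left] at h
  linarith

lemma gradient_eq_of_prox_minimizer_s2 [CompleteSpace E] {f : E → ℝ} {f' : E → E} {L κ : ℝ}
    (hgrad : ∀ x, HasGradientAt f (f' x) x)
    (hlip : ∀ x y, ‖f' x - f' y‖ ≤ L * ‖x - y‖) {γ w x : E}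
    (hmin : ∀ v, f x - ⟪γ, x⟫ + κ * ‖w - x‖ ^ 2 ≤ f v - ⟪γ, v⟫ + κ * ‖w - v‖ ^ 2) :
    f' x = γ + (2 * κ) • (w - x) := by
  set p : E := f' x - γ - (2 * κ) • (w - x) with hp
  have hle : 0 ≤ -‖p‖ ^ 2 := by
    refine nonneg_of_forall_add_mul_nonneg (b := (L / 2 + κ) * ‖p‖ ^ 2) fun t ht _ => ?_
    have h1 := hmin (x + (-t) • p)
    have h2 := quadratic_upper_bound hgrad hlip x ((-t) • p)
    have h3 : w - (x + (-t) • p) = (w - x) + t • p := by module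
    have h4 : ⟪f' x, p⟫ - ⟪γ, p⟫ - 2 * κ * ⟪w - x, p⟫ = ‖p‖ ^ 2 := by
      rw [← real_inner_self_eq_norm_sq p]
      nth_rw 4 [hp]
      simp only [inner_sub_left, real_inner_smul_left]
    rw [h3, norm_add_sq_real, inner_add_right] at h1
    simp only [norm_smul, real_inner_smul_right, mul_pow, Real.norm_eq_abs, abs_neg,
      sq_abs] at h1 h2
    have h5 : 0 ≤ t * (-‖p‖ ^ 2 + t * ((L / 2 + κ) * ‖p‖ ^ 2)) := by
      rw [← h4] at *
      linarith
    exact nonneg_of_mul_nonneg_right h5 ht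
  have h0 : p = 0 := by
    rw [← norm_eq_zero, ← sq_eq_zero_iff]
    linarith [sq_nonneg ‖p‖]
  rw [hp, sub_sub, sub_eq_zero] at h0
  exact h0

lemma subgradient_of_prox_minimizer {R : E → ℝ} (hR : ConvexOn ℝ Set.univ R) {κ : ℝ}
    {g x m : E}
    (hmin : ∀ v, R x + ⟪g, x⟫ + κ * ‖x - m‖ ^ 2 ≤ R v + ⟪g, v⟫ + κ * ‖v - m‖ ^ 2) (y : E) :
    R x + ⟪-g - (2 * κ) • (x - m), y - x⟫ ≤ R y := by
  suffices h : 0 ≤ R y - R x + ⟪g, y - x⟫ + 2 * κ * ⟪x - m, y - x⟫ by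
    rw [inner_sub_left, inner_neg_left, real_inner_smul_left]
    linarith
  refine nonneg_of_forall_add_mul_nonneg (b := κ * ‖y - x‖ ^ 2) fun t ht ht1 => ?_
  have h1 := hmin (x + t • (y - x))
  have h2 := hR.2 (Set.mem_univ x) (Set.mem_univ y) (sub_nonneg.2 ht1) ht.le
    (sub_add_cancel 1 t)
  rw [show (1 - t) • x + t • y = x + t • (y - x) by module, smul_eq_mul, smul_eq_mul] at h2
  rw [show x + t • (y - x) - m = (x - m) + t • (y - x) by abel, norm_add_sq_real,
    inner_add_right, real_inner_smul_right, real_inner_smul_right, norm_smul, mul_pow,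
    Real.norm_eq_abs, sq_abs] at h1
  refine nonneg_of_mul_nonneg_right (a := t) ?_ ht
  linarith

lemma augmented_lagrangian_client_descent {η L a b : ℝ} (hη : 0 < η) {w y z γ γ' : E}
    (hγ : γ' = γ + η⁻¹ • (w - z)) (hlip : ‖γ' - γ‖ ≤ L * ‖z - y‖)
    (hf : b + ⟪γ', y - z⟫ - L / 2 * ‖y - z‖ ^ 2 ≤ a) :
    b + ⟪γ', w - z⟫ + (2 * η)⁻¹ * ‖w - z‖ ^ 2 + ((η⁻¹ - L) / 2 - η * L ^ 2) * ‖z - y‖ ^ 2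
      ≤ a + ⟪γ, w - y⟫ + (2 * η)⁻¹ * ‖w - y‖ ^ 2 := by
  obtain ⟨p, hp⟩ : ∃ p, p = w - z := ⟨_, rfl⟩
  obtain ⟨q, hq⟩ : ∃ q, q = z - y := ⟨_, rfl⟩
  have hwy : w - y = p + q := by rw [hp, hq]; abel
  have hyz : y - z = -q := by rw [hq]; abel
  have hγ2 : γ = γ' - η⁻¹ • p := by rw [hγ, hp]; abel
  have hp2 : η⁻¹ * ‖p‖ ^ 2 ≤ η * L ^ 2 * ‖q‖ ^ 2 := by
    have h1 : γ' - γ = η⁻¹ • p := by rw [hγ2]; abel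
    rw [h1, ← hq, norm_smul, Real.norm_of_nonneg (inv_pos.2 hη).le] at hlip
    have h2 := pow_le_pow_left₀ (by positivity) hlip 2
    calc η⁻¹ * ‖p‖ ^ 2 = η * (η⁻¹ * ‖p‖) ^ 2 := by field_simp
      _ ≤ η * (L * ‖q‖) ^ 2 := by gcongr
      _ = η * L ^ 2 * ‖q‖ ^ 2 := by ring
  rw [hyz, inner_neg_right, norm_neg] at hf
  rw [hwy, ← hp, ← hq, hγ2, norm_add_sq_real, inner_sub_left, inner_add_right,
    inner_add_right, real_inner_smul_left, real_inner_smul_left,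
    real_inner_self_eq_norm_sq, mul_inv]
  linarith

lemma inner_add_norm_sq_expand (κ : ℝ) (γ w x y : E) :
    ⟪γ, w - y⟫ + κ * ‖w - y‖ ^ 2 =
      ⟪γ, x - y⟫ + κ * ‖x - y‖ ^ 2 + ⟪γ + (2 * κ) • (x - y), w - x⟫ + κ * ‖w - x‖ ^ 2 := by
  rw [show w - y = (x - y) + (w - x) by abel, norm_add_sq_real, inner_add_right,
    inner_add_left, real_inner_smul_left]
  ring

end InnerProduct

section Server

variable {d M : ℕ} {η : ℝ} {f : Fin M → Vec d → ℝ} {R : Vec d → ℝ}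

lemma potD_eq (η : ℝ) (f : Fin M → Vec d → ℝ) (R : Vec d → ℝ) (x : Vec d)
    (y γ : Fin M → Vec d) :
    potD η f R x y γ =
      (M : ℝ)⁻¹ * ∑ i, (f i (y i) + ⟪γ i, x - y i⟫ + (2 * η)⁻¹ * ‖x - y i‖ ^ 2) + R x := by
  simp only [potD, sum_add_distrib]
  ring

lemma server_subgradient (hM : 1 ≤ M) (hR : ConvexOn ℝ Set.univ R) {x : Vec d}
    {y γ : Fin M → Vec d}
    (hmin : ∀ v, R x + (M : ℝ)⁻¹ * ∑ i, ⟪γ i, x⟫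
        + (2 * η)⁻¹ * ‖x - (M : ℝ)⁻¹ • ∑ i, y i‖ ^ 2
      ≤ R v + (M : ℝ)⁻¹ * ∑ i, ⟪γ i, v⟫
        + (2 * η)⁻¹ * ‖v - (M : ℝ)⁻¹ • ∑ i, y i‖ ^ 2) :
    -((M : ℝ)⁻¹ • ∑ i, (γ i + η⁻¹ • (x - y i))) ∈ subgrad R x := by
  have hM0 : (M : ℝ) ≠ 0 := by positivity
  have h := subgradient_of_prox_minimizer hR (g := (M : ℝ)⁻¹ • ∑ i, γ i) (x := x)
    (m := (M : ℝ)⁻¹ • ∑ i, y i) (κ := (2 * η)⁻¹) (by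
      intro v
      simpa only [real_inner_smul_left, sum_inner] using hmin v)
  have he : -((M : ℝ)⁻¹ • ∑ i, (γ i + η⁻¹ • (x - y i))) =
      -((M : ℝ)⁻¹ • ∑ i, γ i) - (2 * (2 * η)⁻¹) • (x - (M : ℝ)⁻¹ • ∑ i, y i) := by
    rw [sum_add_distrib, ← smul_sum, sum_sub_distrib, sum_const, card_univ, Fintype.card_fin,
      ← Nat.cast_smul_eq_nsmul ℝ, smul_add, neg_add, smul_comm, smul_sub, smul_smul,
      inv_mul_cancel₀ hM0, one_smul, mul_inv, mul_inv_cancel_left₀ two_ne_zero]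
    abel
  rw [he]
  exact h

lemma potD_server_descent (hM : 1 ≤ M) {x x' : Vec d} {y γ : Fin M → Vec d}
    (hs : -((M : ℝ)⁻¹ • ∑ i, (γ i + η⁻¹ • (x' - y i))) ∈ subgrad R x') :
    potD η f R x' y γ + (2 * η)⁻¹ * ‖x - x'‖ ^ 2 ≤ potD η f R x y γ := by
  have hM0 : (M : ℝ) ≠ 0 := by positivity
  have h := hs x
  have hsum : (M : ℝ)⁻¹ * ∑ i, (f i (y i) + ⟪γ i, x - y i⟫ + (2 * η)⁻¹ * ‖x - y i‖ ^ 2) =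
      (M : ℝ)⁻¹ * ∑ i, (f i (y i) + ⟪γ i, x' - y i⟫ + (2 * η)⁻¹ * ‖x' - y i‖ ^ 2)
        + (M : ℝ)⁻¹ * ∑ i, ⟪γ i + η⁻¹ • (x' - y i), x - x'⟫ + (2 * η)⁻¹ * ‖x - x'‖ ^ 2 := by
    have hc : (2 * η)⁻¹ * ‖x - x'‖ ^ 2 = (M : ℝ)⁻¹ * ∑ _i : Fin M, (2 * η)⁻¹ * ‖x - x'‖ ^ 2 := by
      rw [sum_const, card_univ, Fintype.card_fin, nsmul_eq_mul, inv_mul_cancel_left₀ hM0]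
    rw [hc, ← mul_add, ← mul_add, ← sum_add_distrib, ← sum_add_distrib]
    congr 1
    refine sum_congr rfl fun i _ => ?_
    have := inner_add_norm_sq_expand (2 * η)⁻¹ (γ i) x x' (y i)
    rw [mul_inv, mul_inv_cancel_left₀ two_ne_zero] at this
    rw [mul_inv]
    linarith
  rw [potD_eq, potD_eq, hsum]
  rw [inner_neg_left, real_inner_smul_left, sum_inner] at h
  linarith

end Server

/-- A sequence that decreases by at least `δ n` at each step and converges along a subsequence
stays above its limit, and the decrements tend to zero. -/
lemma decrement_tendsto_zero_of_subseq {E δ : ℕ → ℝ} {φ : ℕ → ℕ} {l : ℝ}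
    (hδ : ∀ n, 0 ≤ δ n) (hE : ∀ n, E (n + 1) + δ n ≤ E n) (hφ : Tendsto φ atTop atTop)
    (hl : Tendsto (E ∘ φ) atTop (𝓝 l)) :
    (∀ n, l ≤ E n) ∧ Tendsto δ atTop (𝓝 0) := by
  have hanti : Antitone E := antitone_nat_of_succ_le fun n => by linarith [hδ n, hE n]
  have hlim : Tendsto E atTop (𝓝 l) := (tendsto_iff_tendsto_subseq_of_antitone hanti hφ).2 hl
  refine ⟨hanti.le_of_tendsto hlim, ?_⟩
  have hsub : Tendsto (fun n => E n - E (n + 1)) atTop (𝓝 0) := by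
    simpa using hlim.sub (hlim.comp (tendsto_add_atTop_nat 1))
  exact squeeze_zero hδ (fun n => by linarith [hE n]) hsub

theorem fedslr_kl_theta_zero_finite_iterations
    (d M : ℕ) (hd : 1 ≤ d) (hM : 1 ≤ M)
    (L ηg : ℝ) (hL : 0 < L) (hηg : 0 < ηg)
    (f : Fin M → Vec d → ℝ) (f' : Fin M → Vec d → Vec d)
    (hgrad : ∀ i x, HasGradientAt (f i) (f' i x) x)
    (hlip : ∀ i (x y : Vec d), ‖f' i x - f' i y‖ ≤ L * ‖x - y‖)
    (R : Vec d → ℝ) (hRconv : ConvexOn ℝ Set.univ R) (hRnn : ∀ x, 0 ≤ R x)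
    (w : ℕ → Vec d) (wi γi : Fin M → ℕ → Vec d)
    (hloc : ∀ i t (v : Vec d),
      f i (wi i (t+1)) - ⟪γi i t, wi i (t+1)⟫ + (2*ηg)⁻¹ * ‖w t - wi i (t+1)‖^2
        ≤ f i v - ⟪γi i t, v⟫ + (2*ηg)⁻¹ * ‖w t - v‖^2)
    (hdual : ∀ i t, γi i (t+1) = γi i t + ηg⁻¹ • (w t - wi i (t+1)))
    (hagg : ∀ t (v : Vec d), v ≠ w (t+1) →
      R (w (t+1)) + (M:ℝ)⁻¹ * ∑ i, ⟪γi i (t+1), w (t+1)⟫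
          + (2*ηg)⁻¹ * ‖w (t+1) - (M:ℝ)⁻¹ • ∑ i, wi i (t+1)‖^2
        < R v + (M:ℝ)⁻¹ * ∑ i, ⟪γi i (t+1), v⟫
          + (2*ηg)⁻¹ * ‖v - (M:ℝ)⁻¹ • ∑ i, wi i (t+1)‖^2)
    (hηg' : ηg < 1 / (2 * L))
    (B : ℝ) (hB : 0 < B) (hBgrad : ∀ i x, ‖f' i x‖ ≤ B)
    (flow : ℝ) (hflow : ∀ i x, flow ≤ f i x)
    (ts : ℕ → ℕ) (hts : StrictMono ts) (hts1 : 1 ≤ ts 0)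
    (wst : Vec d) (wist γist : Fin M → Vec d)
    (hclw : Tendsto (fun j => w (ts j)) atTop (𝓝 wst))
    (hclwi : ∀ i, Tendsto (fun j => wi i (ts j)) atTop (𝓝 (wist i)))
    (hclγ : ∀ i, Tendsto (fun j => γi i (ts j)) atTop (𝓝 (γist i)))
    (c : ℝ) (hc : 0 < c)
    (hKL : ∀ t, 1 ≤ t →
      0 < (potD ηg f R (w t) (fun i => wi i t) (fun i => γi i t) - potD ηg f R wst wist γist) →
      1 ≤ c * Metric.infDist (0 : Tup d M) (subdiffD ηg f' R (w t) (fun i => wi i t) (fun i => γi i t)))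
 :
    ∃ t₀ : ℕ, ∀ T, t₀ ≤ T →
      Metric.infDist (0 : Vec d) {v : Vec d | ∃ s ∈ subgrad R (w T), v = (M:ℝ)⁻¹ • ∑ i, f' i (w T) + s} = 0 := by
  have hMpos : (0 : ℝ) < M := by exact_mod_cast hM
  have hκ : 0 < (2 * ηg)⁻¹ := by positivity
  have hγ : ∀ i n, γi i (n + 1) = f' i (wi i (n + 1)) := by
    intro i n
    rw [gradient_eq_of_prox_minimizer_s2 (hgrad i) (hlip i) (hloc i n), hdual i n, mul_inv,
      mul_inv_cancel_left₀ two_ne_zero]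
  have hsub : ∀ n, -((M : ℝ)⁻¹ • ∑ i, (γi i (n + 1) + ηg⁻¹ • (w (n + 1) - wi i (n + 1))))
      ∈ subgrad R (w (n + 1)) := by
    intro n
    refine server_subgradient hM hRconv fun v => ?_
    rcases eq_or_ne v (w (n + 1)) with rfl | hv
    · exact le_rfl
    · exact (hagg n v hv).le
  obtain ⟨α, hα⟩ : ∃ α, α = (ηg⁻¹ - L) / 2 - ηg * L ^ 2 := ⟨_, rfl⟩
  have hαpos : 0 < α := by
    have ha : ηg * L < 1 / 2 := by
      rw [lt_div_iff₀ (by positivity)] at hηg'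
      linarith
    have hfac : α = ηg⁻¹ * ((1 - ηg * L) / 2 - (ηg * L) ^ 2) := by
      rw [hα]
      field_simp
    rw [hfac]
    have : 0 < ηg * L := by positivity
    exact mul_pos (by positivity) (by nlinarith)
  let δ : ℕ → ℝ := fun n => (M : ℝ)⁻¹ * ∑ i, α * ‖wi i (n + 2) - wi i (n + 1)‖ ^ 2
    + (2 * ηg)⁻¹ * ‖w (n + 1) - w (n + 2)‖ ^ 2
  let D : ℕ → ℝ := fun n =>
    potD ηg f R (w (n + 1)) (fun i => wi i (n + 1)) (fun i => γi i (n + 1))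
  let Dst : ℝ := potD ηg f R wst wist γist
  have hγlip : ∀ i n, ‖γi i (n + 2) - γi i (n + 1)‖ ≤ L * ‖wi i (n + 2) - wi i (n + 1)‖ := by
    intro i n
    rw [hγ i n, hγ i (n + 1)]
    exact hlip i _ _
  have hδ : ∀ n, 0 ≤ δ n := fun n => by positivity
  have hD : ∀ n, D (n + 1) + δ n ≤ D n := by
    intro n
    have hserver := potD_server_descent (f := f) hM (x := w (n + 1)) (hsub (n + 1))
    have hclient : potD ηg f R (w (n + 1)) (fun i => wi i (n + 2)) (fun i => γi i (n + 2))
        + (M : ℝ)⁻¹ * ∑ i, α * ‖wi i (n + 2) - wi i (n + 1)‖ ^ 2 ≤ D n := by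
      simp only [D, potD_eq]
      rw [add_right_comm, ← mul_add, ← sum_add_distrib, hα]
      refine add_le_add_left (mul_le_mul_of_nonneg_left (sum_le_sum fun i _ => ?_)
        (inv_nonneg.2 hMpos.le)) _
      refine augmented_lagrangian_client_descent hηg (hdual i (n + 1)) (hγlip i n) ?_
      have := quadratic_lower_bound (hgrad i) (hlip i) (wi i (n + 2))
        (wi i (n + 1) - wi i (n + 2))
      rwa [add_sub_cancel, ← hγ i (n + 1)] at this
    simp only [D, δ] at hclient ⊢
    linarith
  have hts1' : ∀ j, ts j - 1 + 1 = ts j := fun j =>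
    Nat.sub_add_cancel (hts1.trans (hts.monotone (Nat.zero_le j)))
  have hDst : Tendsto (D ∘ fun j => ts j - 1) atTop (𝓝 Dst) := by
    have hf : ∀ i, Continuous (f i) := fun i =>
      continuous_iff_continuousAt.2 fun x => (hgrad i x).continuousAt
    have hRc : Continuous R := hRconv.locallyLipschitz.continuous
    simp only [D, Dst, Function.comp_def, hts1', potD]
    refine (((tendsto_const_nhds.mul (tendsto_finsetSum _ fun i _ =>
      ((hf i).tendsto _).comp (hclwi i))).add ((hRc.tendsto _).comp hclw)).add
      (tendsto_const_nhds.mul (tendsto_finsetSum _ fun i _ =>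
        (hclγ i).inner (hclw.sub (hclwi i))))).add
      (tendsto_const_nhds.mul (tendsto_finsetSum _ fun i _ =>
        tendsto_const_nhds.mul ((hclw.sub (hclwi i)).norm.pow 2)))
  obtain ⟨hge, hδ0⟩ := decrement_tendsto_zero_of_subseq hδ hD
    ((tendsto_sub_atTop_nat 1).comp hts.tendsto_atTop) hDst
  have hwi_le : ∀ i n, ‖wi i (n + 2) - wi i (n + 1)‖ ^ 2 ≤ M / α * δ n := by
    intro i n
    have h1 : α * ‖wi i (n + 2) - wi i (n + 1)‖ ^ 2 ≤
        ∑ i, α * ‖wi i (n + 2) - wi i (n + 1)‖ ^ 2 :=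
      single_le_sum (f := fun i => α * ‖wi i (n + 2) - wi i (n + 1)‖ ^ 2)
        (fun i _ => by positivity) (mem_univ i)
    have h2 : (M : ℝ)⁻¹ * ∑ i, α * ‖wi i (n + 2) - wi i (n + 1)‖ ^ 2 ≤ δ n :=
      le_add_of_nonneg_right (by positivity)
    rw [inv_mul_le_iff₀ hMpos] at h2
    rw [div_mul_eq_mul_div, le_div_iff₀ hαpos]
    linarith
  have hw_le : ∀ n, ‖w (n + 1) - w (n + 2)‖ ^ 2 ≤ 2 * ηg * δ n := by
    intro n
    have h : (2 * ηg)⁻¹ * ‖w (n + 1) - w (n + 2)‖ ^ 2 ≤ δ n :=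
      le_add_of_nonneg_left (by positivity)
    rwa [inv_mul_le_iff₀ (by positivity)] at h
  have hgap : ∀ i n, ‖w (n + 1) - wi i (n + 2)‖ ≤ ηg * L * ‖wi i (n + 2) - wi i (n + 1)‖ := by
    intro i n
    have h := hγlip i n
    rw [hdual i (n + 1), add_sub_cancel_left, norm_smul, Real.norm_of_nonneg (by positivity),
      inv_mul_le_iff₀ hηg, ← mul_assoc] at h
    exact h
  have hgap' : ∀ i n, ‖w (n + 1) - wi i (n + 1)‖ ≤
      (ηg * L + 1) * ‖wi i (n + 2) - wi i (n + 1)‖ := by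
    intro i n
    have h := norm_add_le (w (n + 1) - wi i (n + 2)) (wi i (n + 2) - wi i (n + 1))
    rw [sub_add_sub_cancel] at h
    linarith [hgap i n]
  have hgap0 : ∀ i, Tendsto (fun n => w (n + 1) - wi i (n + 1)) atTop (𝓝 0) := by
    intro i
    have hb : Tendsto (fun n => (ηg * L + 1) * √(M / α * δ n)) atTop (𝓝 0) := by
      simpa using ((hδ0.const_mul (M / α)).sqrt).const_mul (ηg * L + 1)
    refine squeeze_zero_norm (fun n => (hgap' i n).trans ?_) hb
    gcongr
    exact Real.le_sqrt_of_sq_le (hwi_le i n)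
  let Tp : ℕ → Tup d M := fun n => WithLp.toLp 2 (Sum.elim (fun _ => 0) (Sum.elim
    (fun i => (M : ℝ)⁻¹ • -(ηg⁻¹ • (w (n + 1) - wi i (n + 1))))
    (fun i => (M : ℝ)⁻¹ • (w (n + 1) - wi i (n + 1)))))
  have hTp : ∀ n, Tp n ∈
      subdiffD ηg f' R (w (n + 1)) (fun i => wi i (n + 1)) (fun i => γi i (n + 1)) := by
    intro n
    refine ⟨_, hsub n, ?_, fun i => ?_, fun i => rfl⟩
    · simp only [Tp, Sum.elim_inl, sum_add_distrib, ← smul_sum, smul_add, smul_smul, mul_inv]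
      rw [mul_comm ηg⁻¹]
      abel
    · simp [Tp, hγ i n]
  have hTp0 : Tendsto Tp atTop (𝓝 0) := by
    refine ((PiLp.continuous_toLp 2 _).tendsto 0).comp (tendsto_pi_nhds.2 ?_)
    rintro (_ | i | i)
    · exact tendsto_const_nhds
    · simpa using (((hgap0 i).const_smul ηg⁻¹).neg).const_smul (M : ℝ)⁻¹
    · simpa using (hgap0 i).const_smul (M : ℝ)⁻¹
  have hsmall : ∀ᶠ n in atTop, c * ‖Tp n‖ < 1 := by
    have : Tendsto (fun n => c * ‖Tp n‖) atTop (𝓝 0) := by simpa using hTp0.norm.const_mul c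
    exact this.eventually_lt_const one_pos
  obtain ⟨n₀, hn₀⟩ := eventually_atTop.1 hsmall
  have hDeq : ∀ n, n₀ ≤ n → D n = Dst := by
    intro n hn
    refine le_antisymm (not_lt.1 fun hlt => ?_) (hge n)
    have h1 := hKL (n + 1) (Nat.le_add_left 1 n) (sub_pos.2 hlt)
    have h2 := Metric.infDist_le_dist_of_mem (x := 0) (hTp n)
    rw [dist_zero_left] at h2
    have h3 := mul_le_mul_of_nonneg_left h2 hc.le
    linarith [hn₀ n hn]
  refine ⟨n₀ + 1, fun T hT => ?_⟩
  obtain ⟨n, rfl⟩ : ∃ n, T = n + 1 := ⟨T - 1, by omega⟩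
  have hn : n₀ ≤ n := by omega
  have hδn : δ n = 0 := by
    have := hD n
    rw [hDeq n hn, hDeq (n + 1) (by omega)] at this
    linarith [hδ n]
  have hwi : ∀ i, wi i (n + 1) = w (n + 1) := by
    intro i
    have h1 := hwi_le i n
    rw [hδn, mul_zero] at h1
    have h2 : ‖wi i (n + 2) - wi i (n + 1)‖ = 0 :=
      sq_eq_zero_iff.1 (le_antisymm h1 (sq_nonneg _))
    have h3 := hgap' i n
    rw [h2, mul_zero] at h3
    exact (sub_eq_zero.1 (norm_le_zero_iff.1 h3)).symm
  refine Metric.infDist_zero_of_mem ⟨_, hsub n, ?_⟩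
  simp [hγ, hwi]
end
end

section
/- Bounded gap between global and local models (Lemma: relation of the iterate point and the primal residual). Under the FedSLR setup, for every i ∈ {1,…,M} and every t ≥ 1: ‖w_t − w_{i,t+1}‖ ≤ L η_g ‖w_{i,t+1} − w_{i,t}‖. -/
open Filter Topology Finset MeasureTheory RealInnerProductSpace

noncomputable section

theorem gradient_eq_of_isMin_augmented {E : Type*} [NormedAddCommGroup E] [InnerProductSpace ℝ E]
    [CompleteSpace E] {f : E → ℝ} {g γ w p : E} {η : ℝ} (hf : HasGradientAt f g p)
    (hmin : ∀ v, f p - ⟪γ, p⟫ + (2 * η)⁻¹ * ‖w - p‖ ^ 2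
      ≤ f v - ⟪γ, v⟫ + (2 * η)⁻¹ * ‖w - v‖ ^ 2) :
    g = γ + η⁻¹ • (w - p) := by
  have hderiv := (hf.hasFDerivAt.sub (innerSL ℝ γ).hasFDerivAt).add
    (((hasFDerivAt_id p).const_sub w).norm_sq.const_mul (2 * η)⁻¹)
  have hzero := IsLocalMin.hasFDerivAt_eq_zero (Eventually.of_forall hmin) hderiv
  refine ext_inner_right ℝ fun x => ?_
  have hx := congrArg (fun T => T x) hzero
  simp [inner_add_left, inner_smul_left, inner_sub_left] at hx ⊢
  linarith

theorem fedslr_bounded_gap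
    (d M : ℕ) (hd : 1 ≤ d) (hM : 1 ≤ M)
    (L ηg : ℝ) (hL : 0 < L) (hηg : 0 < ηg)
    (f : Fin M → Vec d → ℝ) (f' : Fin M → Vec d → Vec d)
    (hgrad : ∀ i x, HasGradientAt (f i) (f' i x) x)
    (hlip : ∀ i (x y : Vec d), ‖f' i x - f' i y‖ ≤ L * ‖x - y‖)
    (R : Vec d → ℝ) (hRconv : ConvexOn ℝ Set.univ R) (hRnn : ∀ x, 0 ≤ R x)
    (w : ℕ → Vec d) (wi γi : Fin M → ℕ → Vec d)
    (hloc : ∀ i t (v : Vec d),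
      f i (wi i (t+1)) - ⟪γi i t, wi i (t+1)⟫ + (2*ηg)⁻¹ * ‖w t - wi i (t+1)‖^2
        ≤ f i v - ⟪γi i t, v⟫ + (2*ηg)⁻¹ * ‖w t - v‖^2)
    (hdual : ∀ i t, γi i (t+1) = γi i t + ηg⁻¹ • (w t - wi i (t+1)))
    (hagg : ∀ t (v : Vec d), v ≠ w (t+1) →
      R (w (t+1)) + (M:ℝ)⁻¹ * ∑ i, ⟪γi i (t+1), w (t+1)⟫
          + (2*ηg)⁻¹ * ‖w (t+1) - (M:ℝ)⁻¹ • ∑ i, wi i (t+1)‖^2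
        < R v + (M:ℝ)⁻¹ * ∑ i, ⟪γi i (t+1), v⟫
          + (2*ηg)⁻¹ * ‖v - (M:ℝ)⁻¹ • ∑ i, wi i (t+1)‖^2)
 :
    ∀ (i : Fin M) (t : ℕ), 1 ≤ t →
      ‖w t - wi i (t+1)‖ ≤ L * ηg * ‖wi i (t+1) - wi i t‖ := by
  have hdual_grad : ∀ i t, γi i (t+1) = f' i (wi i (t+1)) := fun i t =>
    (hdual i t).trans (gradient_eq_of_isMin_augmented (hgrad i _) (hloc i t)).symm
  intro i t ht
  obtain ⟨s, rfl⟩ := Nat.exists_eq_add_of_le' ht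
  have hdiff : w (s+1) - wi i (s+1+1)
      = ηg • (f' i (wi i (s+1+1)) - f' i (wi i (s+1))) := by
    rw [← hdual_grad, ← hdual_grad, hdual i (s+1), add_sub_cancel_left, smul_inv_smul₀ hηg.ne']
  rw [hdiff, norm_smul, Real.norm_of_nonneg hηg.le, mul_comm L, mul_assoc]
  exact mul_le_mul_of_nonneg_left (hlip i _ _) hηg.le
end
end

section
/- Lower bound of the potential function at a cluster point (Lemma: lower bound of potential function). Assume the gradients are uniformly bounded (‖∇f_i(w)‖ ≤ B for all i, w), the losses are uniformly bounded below (f_i(w) ≥ f_low for all i, w), and a cluster point exists along a subsequence (t^j). Then the potential function at the cluster point is bounded below: D(w*, (w_i*), (γ_i*)) ≥ f_low − η_g B². -/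
open Filter Topology Finset MeasureTheory RealInnerProductSpace

noncomputable section

/-- First-order optimality condition for a linearly tilted proximal step. -/
lemma eq_gradient_of_isMin_prox {E : Type*} [NormedAddCommGroup E] [InnerProductSpace ℝ E]
    [CompleteSpace E] {f : E → ℝ} {g c a x : E} {η : ℝ} (hf : HasGradientAt f g x)
    (hmin : ∀ v, f x - ⟪c, x⟫ + (2 * η)⁻¹ * ‖a - x‖ ^ 2
      ≤ f v - ⟪c, v⟫ + (2 * η)⁻¹ * ‖a - v‖ ^ 2) :
    c + η⁻¹ • (a - x) = g := by
  have hd := (hf.hasFDerivAt.sub (innerSL ℝ c).hasFDerivAt).add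
    ((((hasFDerivAt_id x).const_sub a).norm_sq).const_mul (2 * η)⁻¹)
  have hloc : IsLocalMin (fun v => f v - ⟪c, v⟫ + (2 * η)⁻¹ * ‖a - v‖ ^ 2) x :=
    Eventually.of_forall hmin
  have h0 := hloc.hasFDerivAt_eq_zero hd
  refine ext_inner_right ℝ fun u => ?_
  have hu := DFunLike.congr_fun h0 u
  simp at hu
  rw [inner_add_left, real_inner_smul_left, inner_sub_left]
  linarith

/-- Completing the square: a tilted quadratic is bounded below in terms of its tilt. -/
lemma neg_le_inner_add_norm_sq {E : Type*} [NormedAddCommGroup E] [InnerProductSpace ℝ E]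
    {c z : E} {η B : ℝ} (hη : 0 < η) (hc : ‖c‖ ≤ B) :
    -(η * B ^ 2) ≤ ⟪c, z⟫ + (2 * η)⁻¹ * ‖z‖ ^ 2 := by
  have h1 : 0 ≤ (2 * η)⁻¹ * ‖z + η • c‖ ^ 2 := by positivity
  have h2 : (2 * η)⁻¹ * ‖z + η • c‖ ^ 2
      = ⟪c, z⟫ + (2 * η)⁻¹ * ‖z‖ ^ 2 + η / 2 * ‖c‖ ^ 2 := by
    rw [norm_add_sq_real, real_inner_smul_right, norm_smul, Real.norm_of_nonneg hη.le,
      real_inner_comm]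
    field_simp
    ring
  have h3 : ‖c‖ ^ 2 ≤ B ^ 2 := by gcongr
  nlinarith [mul_le_mul_of_nonneg_left h3 hη.le, mul_nonneg hη.le (sq_nonneg B)]

theorem fedslr_potential_lower_bound
    (d M : ℕ) (hd : 1 ≤ d) (hM : 1 ≤ M)
    (L ηg : ℝ) (hL : 0 < L) (hηg : 0 < ηg)
    (f : Fin M → Vec d → ℝ) (f' : Fin M → Vec d → Vec d)
    (hgrad : ∀ i x, HasGradientAt (f i) (f' i x) x)
    (hlip : ∀ i (x y : Vec d), ‖f' i x - f' i y‖ ≤ L * ‖x - y‖)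
    (R : Vec d → ℝ) (hRconv : ConvexOn ℝ Set.univ R) (hRnn : ∀ x, 0 ≤ R x)
    (w : ℕ → Vec d) (wi γi : Fin M → ℕ → Vec d)
    (hloc : ∀ i t (v : Vec d),
      f i (wi i (t+1)) - ⟪γi i t, wi i (t+1)⟫ + (2*ηg)⁻¹ * ‖w t - wi i (t+1)‖^2
        ≤ f i v - ⟪γi i t, v⟫ + (2*ηg)⁻¹ * ‖w t - v‖^2)
    (hdual : ∀ i t, γi i (t+1) = γi i t + ηg⁻¹ • (w t - wi i (t+1)))
    (hagg : ∀ t (v : Vec d), v ≠ w (t+1) →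
      R (w (t+1)) + (M:ℝ)⁻¹ * ∑ i, ⟪γi i (t+1), w (t+1)⟫
          + (2*ηg)⁻¹ * ‖w (t+1) - (M:ℝ)⁻¹ • ∑ i, wi i (t+1)‖^2
        < R v + (M:ℝ)⁻¹ * ∑ i, ⟪γi i (t+1), v⟫
          + (2*ηg)⁻¹ * ‖v - (M:ℝ)⁻¹ • ∑ i, wi i (t+1)‖^2)
    (B : ℝ) (hB : 0 < B) (hBgrad : ∀ i x, ‖f' i x‖ ≤ B)
    (flow : ℝ) (hflow : ∀ i x, flow ≤ f i x)
    (ts : ℕ → ℕ) (hts : StrictMono ts) (hts1 : 1 ≤ ts 0)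
    (wst : Vec d) (wist γist : Fin M → Vec d)
    (hclw : Tendsto (fun j => w (ts j)) atTop (𝓝 wst))
    (hclwi : ∀ i, Tendsto (fun j => wi i (ts j)) atTop (𝓝 (wist i)))
    (hclγ : ∀ i, Tendsto (fun j => γi i (ts j)) atTop (𝓝 (γist i)))
 :
    flow - ηg * B^2 ≤ potD ηg f R wst wist γist := by
  have hγ : ∀ i t, ‖γi i (t + 1)‖ ≤ B := fun i t => by
    rw [hdual, eq_gradient_of_isMin_prox (hgrad i _) (hloc i t)]
    exact hBgrad i _
  have hγst : ∀ i, ‖γist i‖ ≤ B := fun i =>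
    le_of_tendsto (hclγ i).norm <| Eventually.of_forall fun j => by
      have hj : 1 ≤ ts j := hts1.trans (hts.monotone j.zero_le)
      simpa [Nat.sub_add_cancel hj] using hγ i (ts j - 1)
  have hterm : ∀ i, flow - ηg * B ^ 2 ≤ f i (wist i) + ⟪γist i, wst - wist i⟫
      + (2 * ηg)⁻¹ * ‖wst - wist i‖ ^ 2 := fun i => by
    linarith [hflow i (wist i), neg_le_inner_add_norm_sq (z := wst - wist i) hηg (hγst i)]
  have hM0 : (0 : ℝ) < M := by exact_mod_cast hM
  have hsum := Finset.card_nsmul_le_sum Finset.univ _ _ fun i _ => hterm i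
  rw [Finset.card_univ, Fintype.card_fin, nsmul_eq_mul, Finset.sum_add_distrib,
    Finset.sum_add_distrib] at hsum
  have havg := (le_inv_mul_iff₀ hM0).2 hsum
  rw [mul_add, mul_add] at havg
  unfold potD
  linarith [hRnn wst]
end
end

section
/- Upper bound on the subdifferential of the potential function (intermediate claim in the proof of Theorem 2). Under the FedSLR setup, for every t ≥ 1: dist(0, ∂D(w_t, (w_{i,t}), (γ_{i,t}))) ≤ (C3/M) Σ_{i=1}^M ‖w_{i,t} − w_{i,t+1}‖, where C3 := L + η_g L + 1/η_g + 1. -/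
open Filter Topology Finset MeasureTheory RealInnerProductSpace

noncomputable section

theorem gradient_eq_of_isMinOn_proximal {E : Type*} [NormedAddCommGroup E] [InnerProductSpace ℝ E]
    [CompleteSpace E] {f : E → ℝ} {g x γ z : E} {η : ℝ}
    (hf : HasGradientAt f g x)
    (hmin : ∀ v, f x - ⟪γ, x⟫ + (2 * η)⁻¹ * ‖z - x‖ ^ 2
      ≤ f v - ⟪γ, v⟫ + (2 * η)⁻¹ * ‖z - v‖ ^ 2) :
    g = γ + η⁻¹ • (z - x) := by
  have hinner : HasFDerivAt (fun v : E => ⟪γ, v⟫) (innerSL ℝ γ) x := (innerSL ℝ γ).hasFDerivAt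
  have hsq : HasFDerivAt (fun v : E => ‖z - v‖ ^ 2) _ x :=
    ((hasFDerivAt_id x).const_sub z).norm_sq
  have hzero := IsLocalMin.hasFDerivAt_eq_zero (Filter.Eventually.of_forall hmin)
    ((hf.hasFDerivAt.sub hinner).add (hsq.const_mul (2 * η)⁻¹))
  refine ext_inner_right ℝ fun v => ?_
  have hv := DFunLike.congr_fun hzero v
  simp at hv
  simp only [inner_add_left, inner_smul_left, inner_sub_left, conj_trivial]
  linear_combination hv

theorem mem_subgrad_of_isMinOn_add_sq {d : ℕ} {R : Vec d → ℝ} (hR : ConvexOn ℝ Set.univ R)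
    {x g m : Vec d} {η : ℝ}
    (hmin : ∀ v, R x + ⟪g, x⟫ + (2 * η)⁻¹ * ‖x - m‖ ^ 2
      ≤ R v + ⟪g, v⟫ + (2 * η)⁻¹ * ‖v - m‖ ^ 2) :
    -(g + η⁻¹ • (x - m)) ∈ subgrad R x := by
  intro y
  set c : ℝ := (2 * η)⁻¹ * ‖y - x‖ ^ 2
  set a : ℝ := R y - R x + ⟪g + η⁻¹ • (x - m), y - x⟫ with ha
  have hline : ∀ l ∈ Set.Ioc (0 : ℝ) 1, 0 ≤ a + l * c := by
    rintro l ⟨hl0, hl1⟩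
    have hconv := hR.2 (Set.mem_univ x) (Set.mem_univ y) (sub_nonneg.2 hl1) hl0.le (by ring)
    have hpt : (1 - l) • x + l • y = x + l • (y - x) := by module
    rw [hpt, smul_eq_mul, smul_eq_mul] at hconv
    have hm := hmin (x + l • (y - x))
    have hexp : ‖x + l • (y - x) - m‖ ^ 2
        = ‖x - m‖ ^ 2 + 2 * (l * ⟪x - m, y - x⟫) + l ^ 2 * ‖y - x‖ ^ 2 := by
      rw [show x + l • (y - x) - m = (x - m) + l • (y - x) by abel, norm_add_sq_real,
        inner_smul_right, norm_smul, mul_pow, Real.norm_eq_abs, sq_abs]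
    rw [hexp, inner_add_right, inner_smul_right] at hm
    have hmul : 0 ≤ l * (a + l * c) := by
      simp only [ha, c, inner_add_left, inner_smul_left, conj_trivial]
      rw [mul_inv] at hm ⊢
      linarith
    exact nonneg_of_mul_nonneg_right hmul hl0
  have hlim : Tendsto (fun l : ℝ => a + l * c) (𝓝[>] 0) (𝓝 a) := by
    have hcont : Continuous fun l : ℝ => a + l * c := by fun_prop
    simpa using (hcont.tendsto 0).mono_left nhdsWithin_le_nhds
  have ha0 : 0 ≤ a := ge_of_tendsto hlim
    (Filter.eventually_of_mem (Ioc_mem_nhdsGT one_pos) hline)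
  rw [inner_neg_left]
  linarith

theorem PiLp.norm_le_sum_norm {ι : Type*} [Fintype ι] {β : ι → Type*}
    [∀ i, SeminormedAddCommGroup (β i)] (x : PiLp 2 β) : ‖x‖ ≤ ∑ i, ‖x i‖ := by
  rw [PiLp.norm_eq_of_L2]
  exact Real.sqrt_le_iff.2 ⟨Finset.sum_nonneg fun i _ => norm_nonneg _,
    Finset.sum_sq_le_sq_sum_of_nonneg fun i _ => norm_nonneg _⟩

theorem fedslr_potential_subdifferential_bound
    (d M : ℕ) (hd : 1 ≤ d) (hM : 1 ≤ M)
    (L ηg : ℝ) (hL : 0 < L) (hηg : 0 < ηg)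
    (f : Fin M → Vec d → ℝ) (f' : Fin M → Vec d → Vec d)
    (hgrad : ∀ i x, HasGradientAt (f i) (f' i x) x)
    (hlip : ∀ i (x y : Vec d), ‖f' i x - f' i y‖ ≤ L * ‖x - y‖)
    (R : Vec d → ℝ) (hRconv : ConvexOn ℝ Set.univ R) (hRnn : ∀ x, 0 ≤ R x)
    (w : ℕ → Vec d) (wi γi : Fin M → ℕ → Vec d)
    (hloc : ∀ i t (v : Vec d),
      f i (wi i (t+1)) - ⟪γi i t, wi i (t+1)⟫ + (2*ηg)⁻¹ * ‖w t - wi i (t+1)‖^2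
        ≤ f i v - ⟪γi i t, v⟫ + (2*ηg)⁻¹ * ‖w t - v‖^2)
    (hdual : ∀ i t, γi i (t+1) = γi i t + ηg⁻¹ • (w t - wi i (t+1)))
    (hagg : ∀ t (v : Vec d), v ≠ w (t+1) →
      R (w (t+1)) + (M:ℝ)⁻¹ * ∑ i, ⟪γi i (t+1), w (t+1)⟫
          + (2*ηg)⁻¹ * ‖w (t+1) - (M:ℝ)⁻¹ • ∑ i, wi i (t+1)‖^2
        < R v + (M:ℝ)⁻¹ * ∑ i, ⟪γi i (t+1), v⟫
          + (2*ηg)⁻¹ * ‖v - (M:ℝ)⁻¹ • ∑ i, wi i (t+1)‖^2)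
    (C3 : ℝ) (hC3 : C3 = L + ηg * L + ηg⁻¹ + 1) :
    ∀ t : ℕ, 1 ≤ t →
      Metric.infDist (0 : Tup d M) (subdiffD ηg f' R (w t) (fun i => wi i t) (fun i => γi i t))
        ≤ C3 / M * ∑ i, ‖wi i t - wi i (t+1)‖ := by
  intro t ht
  obtain ⟨t, rfl⟩ := Nat.exists_eq_succ_of_ne_zero (Nat.one_le_iff_ne_zero.1 ht)
  have hM0 : (0 : ℝ) < M := by exact_mod_cast hM
  have hγ : ∀ i k, γi i (k + 1) = f' i (wi i (k + 1)) := fun i k => by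
    rw [hdual, gradient_eq_of_isMinOn_proximal (hgrad i _) (hloc i k)]
  set x := w (t + 1)
  have hdist : ∀ i, ‖x - wi i (t + 1)‖
      ≤ (1 + ηg * L) * ‖wi i (t + 1) - wi i (t + 1 + 1)‖ := fun i => by
    have hstep : x - wi i (t + 1 + 1)
        = ηg • (f' i (wi i (t + 1 + 1)) - f' i (wi i (t + 1))) := by
      rw [← hγ, ← hγ, hdual i (t + 1), add_sub_cancel_left, smul_inv_smul₀ hηg.ne']
    calc ‖x - wi i (t + 1)‖
        ≤ ‖x - wi i (t + 1 + 1)‖ + ‖wi i (t + 1 + 1) - wi i (t + 1)‖ :=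
          norm_sub_le_norm_sub_add_norm_sub _ _ _
      _ ≤ ηg * (L * ‖wi i (t + 1 + 1) - wi i (t + 1)‖)
          + ‖wi i (t + 1 + 1) - wi i (t + 1)‖ := by
          rw [hstep, norm_smul, Real.norm_of_nonneg hηg.le]
          gcongr
          exact hlip i _ _
      _ = _ := by rw [norm_sub_rev (wi i (t + 1 + 1))]; ring
  set γbar : Vec d := (M : ℝ)⁻¹ • ∑ i, γi i (t + 1) with hγbar
  set m : Vec d := (M : ℝ)⁻¹ • ∑ i, wi i (t + 1) with hm
  have hs : -(γbar + ηg⁻¹ • (x - m)) ∈ subgrad R x := by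
    refine mem_subgrad_of_isMinOn_add_sq hRconv fun v => ?_
    rcases eq_or_ne v x with rfl | hv
    · exact le_rfl
    · simpa only [hγbar, inner_smul_left, sum_inner, conj_trivial] using (hagg t v hv).le
  let T : Tup d M := WithLp.toLp 2 (Sum.elim (fun _ => 0) (Sum.elim
    (fun i => (M : ℝ)⁻¹ • (f' i (wi i (t + 1)) - γi i (t + 1) - ηg⁻¹ • (x - wi i (t + 1))))
    (fun i => (M : ℝ)⁻¹ • (x - wi i (t + 1)))))
  have hT : T ∈ subdiffD ηg f' R x (fun i => wi i (t + 1)) (fun i => γi i (t + 1)) := by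
    refine ⟨_, hs, ?_, fun i => rfl, fun i => rfl⟩
    have hmean : (ηg * M)⁻¹ • ∑ i, (x - wi i (t + 1)) = ηg⁻¹ • (x - m) := by
      rw [Finset.sum_sub_distrib, Finset.sum_const, Finset.card_univ, Fintype.card_fin,
        mul_inv, mul_smul, smul_sub (M : ℝ)⁻¹, ← Nat.cast_smul_eq_nsmul ℝ,
        inv_smul_smul₀ hM0.ne']
    rw [hmean]
    change (0 : Vec d) = _
    abel
  calc Metric.infDist (0 : Tup d M) _ ≤ dist 0 T := Metric.infDist_le_dist_of_mem hT
    _ = ‖T‖ := by rw [dist_zero_left]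
    _ ≤ ∑ j, ‖T j‖ := PiLp.norm_le_sum_norm T
    _ = (M : ℝ)⁻¹ * (ηg⁻¹ + 1) * ∑ i, ‖x - wi i (t + 1)‖ := by
      simp only [T, hγ, Fintype.sum_sum_type, Sum.elim_inl, Sum.elim_inr, sub_self, zero_sub,
        smul_neg, norm_neg, norm_smul, norm_zero, Finset.sum_const_zero, zero_add, norm_inv,
        Real.norm_of_nonneg hηg.le, Real.norm_of_nonneg hM0.le, ← Finset.mul_sum]
      ring
    _ ≤ (M : ℝ)⁻¹ * (ηg⁻¹ + 1)
        * ∑ i, (1 + ηg * L) * ‖wi i (t + 1) - wi i (t + 1 + 1)‖ := by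
      gcongr with i
      exact hdist i
    _ = C3 / M * ∑ i, ‖wi i (t + 1) - wi i (t + 1 + 1)‖ := by
      rw [← Finset.mul_sum, hC3]
      field_simp
      ring
end
end

section
/- KL recursion on the residual (intermediate claim in the proof of Theorem 2). Assume 0 < η_g < 1/(2L). Let D* ∈ ℝ, define r_t := D_t − D*, let θ ∈ [0, 1) and c > 0, and suppose t ≥ 1 is such that r_t > 0 and the KL inequality r_t^θ ≤ c(1−θ)·dist(0, ∂D(w_t, (w_{i,t}), (γ_{i,t}))) holds. Then r_t − r_{t+1} ≥ C4 · r_t^{2θ}, where C2 := 1/(2η_g) − L/2 − L²η_g, C3 := L + η_g L + 1/η_g + 1 and C4 := C2/(C3² c² (1−θ)²). -/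
open Filter Topology Finset MeasureTheory RealInnerProductSpace

noncomputable section

/-- A function with `L`-Lipschitz gradient is bounded below by its quadratic model. -/
theorem quadratic_lower_bound_of_lipschitz_gradient {d : ℕ} {L : ℝ} {f : Vec d → ℝ}
    {f' : Vec d → Vec d} (hgrad : ∀ x, HasGradientAt f (f' x) x)
    (hlip : ∀ x y : Vec d, ‖f' x - f' y‖ ≤ L * ‖x - y‖) (x y : Vec d) :
    f x + ⟪f' x, y - x⟫ - L / 2 * ‖y - x‖ ^ 2 ≤ f y := by
  let g : ℝ → ℝ := fun s => f (x + s • (y - x)) - s * ⟪f' x, y - x⟫ + L / 2 * s ^ 2 * ‖y - x‖ ^ 2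
  have hg : ∀ s, HasDerivAt g
      (⟪f' (x + s • (y - x)), y - x⟫ - ⟪f' x, y - x⟫ + L * s * ‖y - x‖ ^ 2) s := by
    intro s
    have h₁ : HasDerivAt (fun s : ℝ => x + s • (y - x)) (y - x) s := by
      simpa using ((hasDerivAt_id s).smul_const (y - x)).const_add x
    have h₂ := (hgrad (x + s • (y - x))).hasFDerivAt.comp_hasDerivAt s h₁
    have h₃ := (hasDerivAt_id s).mul_const ⟪f' x, y - x⟫
    have h₄ := (((hasDerivAt_id s).pow 2).const_mul (L / 2)).mul_const (‖y - x‖ ^ 2)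
    refine ((h₂.sub h₃).add h₄).congr_deriv ?_
    simp
    left
    ring
  have hmono : MonotoneOn g (Set.Icc 0 1) := by
    refine monotoneOn_of_deriv_nonneg (convex_Icc 0 1)
      (fun s _ => (hg s).continuousAt.continuousWithinAt)
      (fun s _ => (hg s).differentiableAt.differentiableWithinAt) fun s hs => ?_
    rw [interior_Icc] at hs
    rw [(hg s).deriv, ← inner_sub_left]
    have h₁ := neg_le_of_abs_le
      (abs_real_inner_le_norm (f' (x + s • (y - x)) - f' x) (y - x))
    have h₂ := hlip (x + s • (y - x)) x
    rw [add_sub_cancel_left, norm_smul, Real.norm_of_nonneg hs.1.le] at h₂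
    nlinarith [mul_le_mul_of_nonneg_right h₂ (norm_nonneg (y - x))]
  have h := hmono (Set.left_mem_Icc.2 zero_le_one) (Set.right_mem_Icc.2 zero_le_one) zero_le_one
  simp only [g, zero_smul, one_smul, add_zero, add_sub_cancel] at h
  linarith

/-- First-order optimality for a proximal step on a linearly perturbed differentiable function. -/
theorem gradient_eq_of_isMin_prox {d : ℕ} {η : ℝ} {f : Vec d → ℝ} {g γ w x : Vec d}
    (hf : HasGradientAt f g x)
    (hmin : ∀ v, f x - ⟪γ, x⟫ + (2 * η)⁻¹ * ‖w - x‖ ^ 2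
      ≤ f v - ⟪γ, v⟫ + (2 * η)⁻¹ * ‖w - v‖ ^ 2) :
    g = γ + η⁻¹ • (w - x) := by
  have h₁ : HasFDerivAt (fun v : Vec d => f v - ⟪γ, v⟫ + (2 * η)⁻¹ * ‖w - v‖ ^ 2) _ x :=
    (hf.hasFDerivAt.sub (innerSL ℝ γ).hasFDerivAt).add
      ((((hasFDerivAt_id x).const_sub w).norm_sq).const_mul ((2 * η)⁻¹))
  have h₂ := IsLocalMin.hasFDerivAt_eq_zero (Filter.Eventually.of_forall hmin) h₁
  refine ext_inner_right ℝ fun v => ?_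
  have h₃ := congrArg (fun T => T v) h₂
  simp at h₃
  rw [inner_add_left, real_inner_smul_left, inner_sub_left]
  linarith

/-- First-order optimality for a convex function plus a linear and a proximal quadratic term. -/
theorem neg_gradient_mem_subgrad_of_isMin_prox {d : ℕ} {η : ℝ} {R : Vec d → ℝ}
    (hR : ConvexOn ℝ Set.univ R) {γ z x : Vec d}
    (hmin : ∀ v, R x + ⟪γ, x⟫ + (2 * η)⁻¹ * ‖x - z‖ ^ 2
      ≤ R v + ⟪γ, v⟫ + (2 * η)⁻¹ * ‖v - z‖ ^ 2) :
    -(γ + η⁻¹ • (x - z)) ∈ subgrad R x := by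
  intro v
  have key : ∀ s ∈ Set.Ioc (0 : ℝ) 1,
      R x + ⟪-(γ + η⁻¹ • (x - z)), v - x⟫ ≤ R v + s * ((2 * η)⁻¹ * ‖v - x‖ ^ 2) := by
    rintro s ⟨hs₀, hs₁⟩
    have h₁ := hmin (x + s • (v - x))
    have h₂ := hR.2 (Set.mem_univ x) (Set.mem_univ v) (sub_nonneg.2 hs₁) hs₀.le (by ring)
    have h₃ : (1 - s) • x + s • v = x + s • (v - x) := by module
    have h₄ : x + s • (v - x) - z = (x - z) + s • (v - x) := by module
    rw [h₃, smul_eq_mul, smul_eq_mul] at h₂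
    rw [h₄, norm_add_sq_real, norm_smul, mul_pow, Real.norm_of_nonneg hs₀.le, inner_add_right,
      real_inner_smul_right, real_inner_smul_right] at h₁
    rw [inner_neg_left, inner_add_left, real_inner_smul_left]
    rw [mul_inv] at h₁ ⊢
    refine le_of_mul_le_mul_left ?_ hs₀
    nlinarith
  have hlim : Tendsto (fun s : ℝ => R v + s * ((2 * η)⁻¹ * ‖v - x‖ ^ 2)) (𝓝[>] 0) (𝓝 (R v)) := by
    have h : Continuous fun s : ℝ => R v + s * ((2 * η)⁻¹ * ‖v - x‖ ^ 2) := by fun_prop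
    simpa using (h.tendsto 0).mono_left nhdsWithin_le_nhds
  refine ge_of_tendsto hlim ?_
  filter_upwards [Ioc_mem_nhdsGT (zero_lt_one (α := ℝ))] with s hs using key s hs

/-- The mean squared distance to a family of points is the squared distance to its barycentre
up to a constant. -/
theorem mean_norm_sub_sq {d M : ℕ} (hM : M ≠ 0) (y : Fin M → Vec d) (x : Vec d) :
    (M : ℝ)⁻¹ * ∑ i, ‖x - y i‖ ^ 2 = ‖x - (M : ℝ)⁻¹ • ∑ i, y i‖ ^ 2
      + ((M : ℝ)⁻¹ * ∑ i, ‖y i‖ ^ 2 - ‖(M : ℝ)⁻¹ • ∑ i, y i‖ ^ 2) := by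
  have hM' : (M : ℝ) ≠ 0 := Nat.cast_ne_zero.2 hM
  simp only [norm_sub_sq_real, sum_add_distrib, sum_sub_distrib, sum_const, card_univ,
    Fintype.card_fin, nsmul_eq_mul, ← mul_sum, real_inner_smul_right, ← inner_sum]
  field_simp
  ring

/-- Decrease of one client's share of the potential after a primal step from `a` to `b` and the
matching dual step. -/
theorem client_potential_decrease {d : ℕ} {L η : ℝ} (hη : 0 < η) {f : Vec d → ℝ}
    {f' : Vec d → Vec d} (hgrad : ∀ x, HasGradientAt f (f' x) x)
    (hlip : ∀ x y : Vec d, ‖f' x - f' y‖ ≤ L * ‖x - y‖) {w a b : Vec d}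
    (hb : f' b = f' a + η⁻¹ • (w - b)) :
    ((2 * η)⁻¹ - L / 2 - L ^ 2 * η) * ‖b - a‖ ^ 2
      ≤ (f a + ⟪f' a, w - a⟫ + (2 * η)⁻¹ * ‖w - a‖ ^ 2)
        - (f b + ⟪f' b, w - b⟫ + (2 * η)⁻¹ * ‖w - b‖ ^ 2) := by
  have h₁ := quadratic_lower_bound_of_lipschitz_gradient hgrad hlip b a
  have h₂ : w - a = (w - b) - (a - b) := by abel
  have h₃ := hlip b a
  rw [hb, add_sub_cancel_left, norm_smul, Real.norm_of_nonneg (inv_nonneg.2 hη.le)] at h₃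
  have h₄ := pow_le_pow_left₀ (by positivity) h₃ 2
  have h₅ := mul_le_mul_of_nonneg_left h₄ hη.le
  have h₆ : η * (η⁻¹ * ‖w - b‖) ^ 2 = η⁻¹ * ‖w - b‖ ^ 2 := by field_simp
  rw [h₆] at h₅
  rw [norm_sub_rev a b] at h₁
  rw [h₂, norm_sub_sq_real (w - b) (a - b), norm_sub_rev a b, inner_sub_right, hb, inner_add_left,
    real_inner_smul_left, real_inner_self_eq_norm_sq]
  rw [hb, inner_add_left, real_inner_smul_left] at h₁
  rw [mul_inv] at *
  linarith

/-- If the dual variables are the client gradients and `x` solves the aggregation step, the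
subdifferential of the potential has an element controlled by the primal residuals. -/
theorem sq_infDist_subdiffD_le {d M : ℕ} (hM : M ≠ 0) {η : ℝ} {f' : Fin M → Vec d → Vec d}
    {R : Vec d → ℝ} (hR : ConvexOn ℝ Set.univ R) {x : Vec d} {y γ : Fin M → Vec d}
    (hγ : ∀ i, f' i (y i) = γ i)
    (hmin : ∀ v, R x + ⟪(M : ℝ)⁻¹ • ∑ i, γ i, x⟫
        + (2 * η)⁻¹ * ‖x - (M : ℝ)⁻¹ • ∑ i, y i‖ ^ 2
      ≤ R v + ⟪(M : ℝ)⁻¹ • ∑ i, γ i, v⟫ + (2 * η)⁻¹ * ‖v - (M : ℝ)⁻¹ • ∑ i, y i‖ ^ 2) :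
    Metric.infDist (0 : Tup d M) (subdiffD η f' R x y γ) ^ 2
      ≤ (M : ℝ)⁻¹ * (M : ℝ)⁻¹ * (1 + η⁻¹ ^ 2) * ∑ i, ‖x - y i‖ ^ 2 := by
  have hM' : (M : ℝ) ≠ 0 := Nat.cast_ne_zero.2 hM
  let T : Tup d M := WithLp.toLp 2 (Sum.elim (fun _ => 0) (Sum.elim
    (fun i => (M : ℝ)⁻¹ • (-(η⁻¹ • (x - y i)))) (fun i => (M : ℝ)⁻¹ • (x - y i))))
  have hT : T ∈ subdiffD η f' R x y γ := by
    refine ⟨_, neg_gradient_mem_subgrad_of_isMin_prox hR hmin, ?_, fun i => ?_, fun i => rfl⟩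
    · change (0 : Vec d) = _
      have h : (η * M)⁻¹ * (M : ℝ) = η⁻¹ := by
        rw [mul_inv, mul_assoc, inv_mul_cancel₀ hM', mul_one]
      rw [sum_sub_distrib, sum_const, card_univ, Fintype.card_fin, ← Nat.cast_smul_eq_nsmul ℝ,
        smul_sub (η * M)⁻¹, smul_smul _ (M : ℝ), h, mul_inv, mul_smul]
      module
    · simp [T, hγ]
  have h := Metric.infDist_le_dist_of_mem (x := (0 : Tup d M)) hT
  rw [dist_zero_left] at h
  refine (pow_le_pow_left₀ Metric.infDist_nonneg h 2).trans_eq ?_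
  rw [PiLp.norm_sq_eq_of_L2]
  simp only [T, Fintype.sum_sum_type, Sum.elim_inl, Sum.elim_inr, norm_zero, norm_smul,
    norm_neg, mul_pow, norm_inv, Real.norm_natCast, ← mul_sum]
  simp
  ring

theorem fedslr_kl_recursion
    (d M : ℕ) (hd : 1 ≤ d) (hM : 1 ≤ M)
    (L ηg : ℝ) (hL : 0 < L) (hηg : 0 < ηg)
    (f : Fin M → Vec d → ℝ) (f' : Fin M → Vec d → Vec d)
    (hgrad : ∀ i x, HasGradientAt (f i) (f' i x) x)
    (hlip : ∀ i (x y : Vec d), ‖f' i x - f' i y‖ ≤ L * ‖x - y‖)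
    (R : Vec d → ℝ) (hRconv : ConvexOn ℝ Set.univ R) (hRnn : ∀ x, 0 ≤ R x)
    (w : ℕ → Vec d) (wi γi : Fin M → ℕ → Vec d)
    (hloc : ∀ i t (v : Vec d),
      f i (wi i (t+1)) - ⟪γi i t, wi i (t+1)⟫ + (2*ηg)⁻¹ * ‖w t - wi i (t+1)‖^2
        ≤ f i v - ⟪γi i t, v⟫ + (2*ηg)⁻¹ * ‖w t - v‖^2)
    (hdual : ∀ i t, γi i (t+1) = γi i t + ηg⁻¹ • (w t - wi i (t+1)))
    (hagg : ∀ t (v : Vec d), v ≠ w (t+1) →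
      R (w (t+1)) + (M:ℝ)⁻¹ * ∑ i, ⟪γi i (t+1), w (t+1)⟫
          + (2*ηg)⁻¹ * ‖w (t+1) - (M:ℝ)⁻¹ • ∑ i, wi i (t+1)‖^2
        < R v + (M:ℝ)⁻¹ * ∑ i, ⟪γi i (t+1), v⟫
          + (2*ηg)⁻¹ * ‖v - (M:ℝ)⁻¹ • ∑ i, wi i (t+1)‖^2)
    (hηg' : ηg < 1 / (2 * L))
    (Dst θ c : ℝ) (hθ : 0 ≤ θ) (hθ' : θ < 1) (hc : 0 < c)
    (t : ℕ) (ht : 1 ≤ t)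
    (hrt : 0 < potD ηg f R (w t) (fun i => wi i t) (fun i => γi i t) - Dst)
    (hKL : (potD ηg f R (w t) (fun i => wi i t) (fun i => γi i t) - Dst) ^ θ
      ≤ c * (1 - θ) *
        Metric.infDist (0 : Tup d M) (subdiffD ηg f' R (w t) (fun i => wi i t) (fun i => γi i t)))
    (C2 C3 C4 : ℝ)
    (hC2 : C2 = (2*ηg)⁻¹ - L/2 - L^2 * ηg)
    (hC3 : C3 = L + ηg * L + ηg⁻¹ + 1)
    (hC4 : C4 = C2 / (C3^2 * c^2 * (1 - θ)^2)) :
    C4 * (potD ηg f R (w t) (fun i => wi i t) (fun i => γi i t) - Dst) ^ (2*θ)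
      ≤ (potD ηg f R (w t) (fun i => wi i t) (fun i => γi i t) - Dst)
        - (potD ηg f R (w (t+1)) (fun i => wi i (t+1)) (fun i => γi i (t+1)) - Dst) := by
  have hM0 : M ≠ 0 := by omega
  have hMpos : (0 : ℝ) < M := by positivity
  have hM1 : (1 : ℝ) ≤ M := by exact_mod_cast hM
  have hγ : ∀ i s, f' i (wi i (s + 1)) = γi i (s + 1) := fun i s => by
    rw [hdual, gradient_eq_of_isMin_prox (hgrad i _) (hloc i s)]
  have hagg' : ∀ s (v : Vec d),
      R (w (s+1)) + ⟪(M:ℝ)⁻¹ • ∑ i, γi i (s+1), w (s+1)⟫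
          + (2*ηg)⁻¹ * ‖w (s+1) - (M:ℝ)⁻¹ • ∑ i, wi i (s+1)‖^2
        ≤ R v + ⟪(M:ℝ)⁻¹ • ∑ i, γi i (s+1), v⟫
          + (2*ηg)⁻¹ * ‖v - (M:ℝ)⁻¹ • ∑ i, wi i (s+1)‖^2 := by
    intro s v
    rcases eq_or_ne v (w (s+1)) with rfl | hv
    · exact le_rfl
    · simpa only [real_inner_smul_left, sum_inner] using (hagg s v hv).le
  obtain ⟨n, rfl⟩ := Nat.exists_eq_add_of_le' ht
  set S : ℝ := ∑ i, ‖wi i (n + 1 + 1) - wi i (n + 1)‖ ^ 2 with hS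
  have hS0 : 0 ≤ S := by positivity
  have hstep : ∀ i, f' i (wi i (n + 1 + 1))
      = f' i (wi i (n + 1)) + ηg⁻¹ • (w (n + 1) - wi i (n + 1 + 1)) := fun i => by
    rw [hγ, hγ, hdual]
  have hdesc : C2 * ((M : ℝ)⁻¹ * S)
      ≤ potD ηg f R (w (n + 1)) (fun i => wi i (n + 1)) (fun i => γi i (n + 1))
        - potD ηg f R (w (n + 1 + 1)) (fun i => wi i (n + 1 + 1))
          (fun i => γi i (n + 1 + 1)) := by
    have h₁ := sum_le_sum fun i (_ : i ∈ univ) =>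
      client_potential_decrease hηg (hgrad i) (hlip i) (hstep i)
    rw [← mul_sum, ← hC2, ← hS] at h₁
    have h₂ := mul_le_mul_of_nonneg_left h₁ (inv_nonneg.2 hMpos.le)
    have h₃ := hagg' (n + 1) (w (n + 1))
    have h₄ := mean_norm_sub_sq hM0 (fun i => wi i (n + 1 + 1)) (w (n + 1))
    have h₅ := mean_norm_sub_sq hM0 (fun i => wi i (n + 1 + 1)) (w (n + 1 + 1))
    simp only [real_inner_smul_left, sum_inner] at h₃
    simp only [hγ, sum_sub_distrib, sum_add_distrib, inner_sub_right, ← mul_sum] at h₂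
    simp only [potD, inner_sub_right, sum_sub_distrib, ← mul_sum]
    linear_combination h₂ + h₃ + (2 * ηg)⁻¹ * (h₅ - h₄)
  have hdist : Metric.infDist (0 : Tup d M)
      (subdiffD ηg f' R (w (n + 1)) (fun i => wi i (n + 1)) (fun i => γi i (n + 1))) ^ 2
        ≤ C3 ^ 2 * ((M : ℝ)⁻¹ * S) := by
    refine (sq_infDist_subdiffD_le hM0 hRconv (fun i => hγ i n) (hagg' n)).trans ?_
    have hi : ∀ i, ‖w (n + 1) - wi i (n + 1)‖ ^ 2
        ≤ (1 + ηg * L) ^ 2 * ‖wi i (n + 1 + 1) - wi i (n + 1)‖ ^ 2 := by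
      intro i
      have e : w (n + 1) - wi i (n + 1)
          = ηg • (f' i (wi i (n + 1 + 1)) - f' i (wi i (n + 1)))
            + (wi i (n + 1 + 1) - wi i (n + 1)) := by
        rw [hstep, add_sub_cancel_left, smul_inv_smul₀ hηg.ne']
        abel
      rw [← mul_pow]
      refine pow_le_pow_left₀ (norm_nonneg _) ?_ 2
      rw [e]
      refine (norm_add_le _ _).trans ?_
      rw [norm_smul, Real.norm_of_nonneg hηg.le]
      nlinarith [mul_le_mul_of_nonneg_left (hlip i (wi i (n + 1 + 1)) (wi i (n + 1))) hηg.le]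
    have hsum : ∑ i, ‖w (n + 1) - wi i (n + 1)‖ ^ 2 ≤ (1 + ηg * L) ^ 2 * S := by
      rw [hS, mul_sum]
      exact sum_le_sum fun i _ => hi i
    have hMM : (M : ℝ)⁻¹ * (M : ℝ)⁻¹ ≤ (M : ℝ)⁻¹ :=
      mul_le_of_le_one_left (by positivity) (inv_le_one_of_one_le₀ hM1)
    have hηsq : 1 + ηg⁻¹ ^ 2 ≤ (1 + ηg⁻¹) ^ 2 := by
      have := inv_pos.2 hηg
      nlinarith
    have hC3' : C3 = (1 + ηg⁻¹) * (1 + ηg * L) := by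
      rw [hC3]
      field_simp
      ring
    calc _ ≤ (M : ℝ)⁻¹ * (1 + ηg⁻¹) ^ 2 * ((1 + ηg * L) ^ 2 * S) := by
          refine mul_le_mul (mul_le_mul hMM hηsq ?_ ?_) hsum ?_ ?_ <;> positivity
      _ = C3 ^ 2 * ((M : ℝ)⁻¹ * S) := by
          rw [hC3']
          ring
  have hC2pos : 0 < C2 := by
    have h : ηg * L < 1 / 2 := by
      rw [lt_div_iff₀ (by positivity)] at hηg'
      linarith
    have e : C2 = (2 * ηg)⁻¹ * ((1 + ηg * L) * (1 - 2 * (ηg * L))) := by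
      rw [hC2]
      field_simp
      ring
    rw [e]
    have : 0 < 1 - 2 * (ηg * L) := by linarith
    positivity
  have hC3pos : 0 < C3 := by
    rw [hC3]
    positivity
  have hθ₁ : 0 < 1 - θ := sub_pos.2 hθ'
  rw [sub_sub_sub_cancel_right]
  refine le_trans ?_ hdesc
  have hpow := pow_le_pow_left₀ (Real.rpow_nonneg hrt.le θ) hKL 2
  rw [← Real.rpow_mul_natCast hrt.le, Nat.cast_ofNat, mul_comm θ 2] at hpow
  have hC4pos : 0 ≤ C4 := by
    rw [hC4]
    positivity
  calc _ ≤ C4 * ((c * (1 - θ)) ^ 2 * (C3 ^ 2 * ((M : ℝ)⁻¹ * S))) := by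
        refine mul_le_mul_of_nonneg_left (hpow.trans ?_) hC4pos
        rw [mul_pow]
        gcongr
    _ = C2 * ((M : ℝ)⁻¹ * S) := by
        rw [hC4]
        field_simp
end
end

section
/- Sublinear decay of a sequence satisfying the KL-type recursion with exponent θ ∈ (1/2, 1) (real-sequence step in the proof of Theorem 2, third case). Let θ ∈ (1/2, 1), C > 0, and let (r_t)_{t≥0} be a sequence of real numbers with r_t > 0 for all t and r_t − r_{t+1} ≥ C·r_t^{2θ} for all t. Then for every T ≥ 1: r_T^{1−2θ} ≥ T·(2θ−1)·C, and consequently r_T ≤ ((2θ−1)·C·T)^{1/(1−2θ)}. -/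
open Filter Topology

/-- Bernoulli's inequality for nonpositive real exponents. -/
theorem one_add_mul_sub_one_le_rpow_of_nonpos {s q : ℝ} (hs : 0 < s) (hq : q ≤ 0) :
    1 + q * (s - 1) ≤ s ^ q := by
  rw [Real.rpow_def_of_pos hs]
  have hexp := Real.add_one_le_exp (Real.log s * q)
  have hlog := mul_le_mul_of_nonpos_left (Real.log_le_sub_one_of_pos hs) hq
  linarith

/-- For a nonpositive exponent, the graph of a real power lies above its tangent lines. -/
theorem rpow_add_mul_sub_le_rpow_of_nonpos {x y q : ℝ} (hx : 0 < x) (hy : 0 < y) (hq : q ≤ 0) :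
    x ^ q + q * x ^ (q - 1) * (y - x) ≤ y ^ q := by
  have h := mul_le_mul_of_nonneg_left
    (one_add_mul_sub_one_le_rpow_of_nonpos (div_pos hy hx) hq) (Real.rpow_nonneg hx.le q)
  rw [← Real.mul_rpow hx.le (div_pos hy hx).le, mul_div_cancel₀ _ hx.ne'] at h
  refine le_of_eq_of_le ?_ h
  rw [Real.rpow_sub_one hx.ne']
  field_simp

/-- One step of the recursion increases `x ^ (1 - 2 * θ)` by at least `(2 * θ - 1) * C`. -/
theorem rpow_add_le_rpow_of_mul_rpow_le_sub {θ C x y : ℝ} (hθ : 1 / 2 ≤ θ) (hx : 0 < x)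
    (hy : 0 < y) (h : C * x ^ (2 * θ) ≤ x - y) :
    x ^ (1 - 2 * θ) + (2 * θ - 1) * C ≤ y ^ (1 - 2 * θ) := by
  have htangent := rpow_add_mul_sub_le_rpow_of_nonpos hx hy (by linarith : 1 - 2 * θ ≤ 0)
  have hexp : (1 - 2 * θ - 1 : ℝ) = -(2 * θ) := by ring
  rw [hexp, Real.rpow_neg hx.le] at htangent
  have hC : C ≤ (x ^ (2 * θ))⁻¹ * (x - y) := by
    rw [inv_mul_eq_div]
    exact (le_div_iff₀ (Real.rpow_pos_of_pos hx _)).2 h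
  have hmul := mul_le_mul_of_nonneg_left hC (by linarith : 0 ≤ 2 * θ - 1)
  linarith

theorem residual_sublinear_decay
    (θ C : ℝ) (hθ : 1/2 < θ) (hθ' : θ < 1) (hC : 0 < C)
    (r : ℕ → ℝ) (hpos : ∀ t, 0 < r t)
    (hrec : ∀ t, C * r t ^ (2*θ) ≤ r t - r (t+1)) :
    ∀ T : ℕ, 1 ≤ T →
      (T : ℝ) * (2*θ - 1) * C ≤ r T ^ (1 - 2*θ) ∧
      r T ≤ ((2*θ - 1) * C * T) ^ (1 / (1 - 2*θ)) := by
  have hlower (T : ℕ) : (T : ℝ) * (2*θ - 1) * C ≤ r T ^ (1 - 2*θ) := by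
    induction T with
    | zero => simpa using Real.rpow_nonneg (hpos 0).le _
    | succ T ih =>
      have hstep := rpow_add_le_rpow_of_mul_rpow_le_sub hθ.le (hpos T) (hpos (T + 1)) (hrec T)
      push_cast
      linarith
  intro T hT
  refine ⟨hlower T, ?_⟩
  have hT' : (0 : ℝ) < T := by exact_mod_cast hT
  have hbase : 0 < (2*θ - 1) * C * T := mul_pos (mul_pos (by linarith) hC) hT'
  have hle : (2*θ - 1) * C * T ≤ r T ^ (1 - 2*θ) := by linarith [hlower T]
  have hroot := Real.rpow_le_rpow_of_nonpos hbase hle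
    (one_div_nonpos.2 (by linarith : 1 - 2*θ ≤ 0))
  rwa [← Real.rpow_mul (hpos T).le, mul_one_div_cancel (by linarith), Real.rpow_one] at hroot
end
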